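/- arXiv:quant-ph/9807008 — 3 statements merged into one kernel-verified Lean document; each statement's English description precedes it below -/
import Mathlib

section
/- Let 𝒳 be a finite set, P a probability distribution on 𝒳, (W_x)_{x∈𝒳} a family of density matrices on M_n(ℂ), and (Y_j)_{j∈Ω} a POVM on M_n(ℂ) indexed by a finite set Ω. Let χ(P,W) = H(Σ_x P(x) W_x) − Σ_x P(x) H(W_x) be the Holevo quantity. Then the classical mutual information of the joint distribution P(x,j) = P(x)·Tr(W_x Y_j) on 𝒳×Ω is at most χ(P,W), and moreover χ(P,W) ≤ H(P), the Shannon entropy of P. (Holevo bound.) -/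
open scoped ComplexOrder Kronecker
open Matrix

noncomputable def negMulLogb (x : ℝ) : ℝ := -(x * Real.logb 2 x)

noncomputable def shannonEntropy {α : Type*} [Fintype α] (p : α → ℝ) : ℝ :=
  ∑ i, negMulLogb (p i)

noncomputable def mutualInfo {α β : Type*} [Fintype α] [Fintype β]
    (p : α → β → ℝ) : ℝ :=
  shannonEntropy (fun i => ∑ j, p i j) + shannonEntropy (fun j => ∑ i, p i j)
    - shannonEntropy (fun ij : α × β => p ij.1 ij.2)

noncomputable def binEnt (t : ℝ) : ℝ := negMulLogb t + negMulLogb (1 - t)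

noncomputable def vnEntropy {α : Type*} [Fintype α] [DecidableEq α]
    (ρ : Matrix α α ℂ) : ℝ :=
  if h : ρ.IsHermitian then ∑ i, negMulLogb (h.eigenvalues i) else 0

noncomputable def matLogb {α : Type*} [Fintype α] [DecidableEq α]
    (A : Matrix α α ℂ) : Matrix α α ℂ :=
  if h : A.IsHermitian then
    (h.eigenvectorUnitary : Matrix α α ℂ) *
      Matrix.diagonal (fun i => (Real.logb 2 (h.eigenvalues i) : ℂ)) *
      star (h.eigenvectorUnitary : Matrix α α ℂ)
  else 0

def MatState {α : Type*} [Fintype α] [DecidableEq α] (ρ : Matrix α α ℂ) : Prop :=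
  ρ.PosSemidef ∧ ρ.trace = 1

def IsProjn {α : Type*} [Fintype α] [DecidableEq α] (p : Matrix α α ℂ) : Prop :=
  p.IsHermitian ∧ p * p = p

def IsMinProjOf {α : Type*} [Fintype α] [DecidableEq α]
    (X : StarSubalgebra ℂ (Matrix α α ℂ)) (p : Matrix α α ℂ) : Prop :=
  p ∈ X ∧ IsProjn p ∧ p ≠ 0 ∧
    ∀ q ∈ X, IsProjn q → q * p = q → q = 0 ∨ q = p

def IsCanonicalTrace {α : Type*} [Fintype α] [DecidableEq α]
    (X : StarSubalgebra ℂ (Matrix α α ℂ)) (τ : Matrix α α ℂ →ₗ[ℂ] ℂ) : Prop :=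
  (∀ x ∈ X, ∀ y ∈ X, τ (x * y) = τ (y * x)) ∧
  (∀ x ∈ X, 0 ≤ τ (star x * x)) ∧
  (∀ p, IsMinProjOf X p → τ p = 1)

def IsRestriction {α : Type*} [Fintype α] [DecidableEq α]
    (X : StarSubalgebra ℂ (Matrix α α ℂ)) (τ : Matrix α α ℂ →ₗ[ℂ] ℂ)
    (ρ r : Matrix α α ℂ) : Prop :=
  r ∈ X ∧ r.PosSemidef ∧ ∀ x ∈ X, τ (r * x) = (ρ * x).trace

noncomputable def algEntropy {α : Type*} [Fintype α] [DecidableEq α]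
    (τ : Matrix α α ℂ →ₗ[ℂ] ℂ) (r : Matrix α α ℂ) : ℝ :=
  -(τ (r * matLogb r)).re

def IsAlgEntropy {α : Type*} [Fintype α] [DecidableEq α]
    (X : StarSubalgebra ℂ (Matrix α α ℂ)) (ρ : Matrix α α ℂ) (H : ℝ) : Prop :=
  ∃ τ r, IsCanonicalTrace X τ ∧ IsRestriction X τ ρ r ∧ H = algEntropy τ r

def CompatibleAlg {α : Type*} [Fintype α] [DecidableEq α]
    (X Y : StarSubalgebra ℂ (Matrix α α ℂ)) : Prop :=
  ∀ x ∈ X, ∀ y ∈ Y, x * y = y * x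

/-- If `∑ m' / (t' + s) ≤ ∑ m / (t + s)` for all `s > 0` and both families of weights have the
same total mass, then `∑ m' log t'⁻¹ ≤ ∑ m log t⁻¹`. -/
lemma sum_mul_neg_log_le_of_resolvent_le {ι κ : Type*} [Fintype ι] [Fintype κ]
    (m t : ι → ℝ) (m' t' : κ → ℝ) (ht : ∀ i, 0 ≤ t i) (ht' : ∀ j, 0 ≤ t' j)
    (hpos : ∀ i, m i ≠ 0 → 0 < t i) (hpos' : ∀ j, m' j ≠ 0 → 0 < t' j)
    (hmass : ∑ i, m i = ∑ j, m' j)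
    (hres : ∀ s, 0 < s → ∑ j, m' j / (t' j + s) ≤ ∑ i, m i / (t i + s)) :
    ∑ j, m' j * -Real.log (t' j) ≤ ∑ i, m i * -Real.log (t i) := by
  set G : ℝ → ℝ := fun s => ∑ i, m i * Real.log (t i + s) - ∑ j, m' j * Real.log (t' j + s)
    with hG
  have hderiv : ∀ s, 0 < s →
      HasDerivAt G (∑ i, m i / (t i + s) - ∑ j, m' j / (t' j + s)) s := by
    intro s hs
    have key : ∀ c w : ℝ, 0 ≤ c → HasDerivAt (fun s => w * Real.log (c + s)) (w / (c + s)) s := by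
      intro c w hc
      have h := (((hasDerivAt_id s).const_add c).log
        (by simp only [id]; positivity)).const_mul w
      exact (mul_one_div w (c + s)) ▸ h
    exact (HasDerivAt.fun_sum fun i _ => key _ _ (ht i)).sub
      (HasDerivAt.fun_sum fun j _ => key _ _ (ht' j))
  have hmono : MonotoneOn G (Set.Ioi 0) := by
    refine monotoneOn_of_deriv_nonneg (convex_Ioi 0)
      (fun s hs => (hderiv s hs).continuousAt.continuousWithinAt)
      (fun s hs => ?_) (fun s hs => ?_)
    · rw [interior_Ioi] at hs
      exact (hderiv s hs).differentiableAt.differentiableWithinAt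
    · rw [interior_Ioi] at hs
      rw [(hderiv s hs).deriv]
      exact sub_nonneg.2 (hres s hs)
  have hzero : Filter.Tendsto G (nhdsWithin 0 (Set.Ioi 0)) (nhds (G 0)) := by
    have key : ∀ c w : ℝ, (w ≠ 0 → 0 < c) →
        ContinuousAt (fun s => w * Real.log (c + s)) 0 := by
      intro c w hc
      by_cases hw : w = 0
      · simpa [hw] using continuousAt_const
      · have := hc hw
        refine continuousAt_const.mul (ContinuousAt.log (by fun_prop) ?_)
        simpa using this.ne'
    have hc : ContinuousAt G 0 :=
      (tendsto_finsetSum _ fun i _ => key _ _ (hpos i)).sub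
        (tendsto_finsetSum _ fun j _ => key _ _ (hpos' j))
    exact hc.tendsto.mono_left nhdsWithin_le_nhds
  have htop : Filter.Tendsto G Filter.atTop (nhds 0) := by
    have key : ∀ c w : ℝ, Filter.Tendsto (fun s => w * (Real.log (c + s) - Real.log s))
        Filter.atTop (nhds 0) := by
      intro c w
      simpa [add_comm] using (Real.tendsto_log_comp_add_sub_log c).const_mul w
    have h := (tendsto_finsetSum Finset.univ fun i _ => key (t i) (m i)).sub
        (tendsto_finsetSum Finset.univ fun j _ => key (t' j) (m' j))
    simp only [Finset.sum_const_zero, sub_zero] at h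
    refine h.congr fun s => ?_
    simp only [hG, mul_sub, Finset.sum_sub_distrib, ← Finset.sum_mul, hmass]
    ring
  have hle : ∀ s, 0 < s → G s ≤ 0 := fun s hs =>
    ge_of_tendsto htop (Filter.eventually_atTop.2
      ⟨s, fun r hr => hmono hs (lt_of_lt_of_le hs hr : (0 : ℝ) < r) hr⟩)
  have h0 : G 0 ≤ 0 := le_of_tendsto hzero (eventually_nhdsWithin_of_forall hle)
  simp only [hG, add_zero] at h0
  simp only [mul_neg, Finset.sum_neg_distrib]
  linarith

section SpectralForms

variable {n : Type*} [Fintype n] [DecidableEq n]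

open scoped MatrixOrder in
lemma Matrix.PosSemidef.re_trace_mul_nonneg {A B : Matrix n n ℂ} (hA : A.PosSemidef)
    (hB : B.PosSemidef) : 0 ≤ (A * B).trace.re := by
  obtain ⟨C, rfl⟩ : ∃ C : Matrix n n ℂ, A = Cᴴ * C := by
    exact CStarAlgebra.nonneg_iff_eq_star_mul_self.1 hA.nonneg
  rw [Matrix.mul_assoc, Matrix.trace_mul_comm]
  exact (Complex.nonneg_iff.1 (hB.mul_mul_conjTranspose_same C).trace_nonneg).1

lemma re_trace_conj_diagonal_mul (E M : Matrix n n ℂ) (a : n → ℝ) :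
    ((E * diagonal (fun i => (a i : ℂ)) * Eᴴ) * M).trace.re
      = ∑ i, a i * ((Eᴴ * M * E) i i).re := by
  rw [Matrix.mul_assoc, Matrix.mul_assoc, Matrix.trace_mul_comm, Matrix.mul_assoc, Matrix.trace]
  simp [Matrix.diagonal_mul, Complex.re_sum, Matrix.mul_assoc]

/-- The data of two Hermitian matrices `ρ`, `σ` written in eigenbases, given by the columns of
the unitary matrices `E`, `F`, with eigenvalues `a`, `b`. -/
structure SpectralPair (ρ σ E F : Matrix n n ℂ) (a b : n → ℝ) : Prop where
  left_unitary : Eᴴ * E = 1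
  right_unitary : Fᴴ * F = 1
  left_eq : ρ = E * diagonal (fun i => (a i : ℂ)) * Eᴴ
  right_eq : σ = F * diagonal (fun i => (b i : ℂ)) * Fᴴ
  left_nonneg : ∀ i, 0 ≤ a i
  right_nonneg : ∀ i, 0 ≤ b i

/-- Squared moduli of the overlaps between the columns of `E` and those of `F`. -/
noncomputable def overlap (E F : Matrix n n ℂ) (i k : n) : ℝ := Complex.normSq ((Eᴴ * F) i k)

namespace SpectralPair

variable {ρ σ E F : Matrix n n ℂ} {a b : n → ℝ} (h : SpectralPair ρ σ E F a b)
include h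

lemma re_trace_mul (X : Matrix n n ℂ) :
    (ρ * X).trace.re
      = ∑ i, ∑ k, a i * ((Eᴴ * X * F) i k * star ((Eᴴ * F) i k)).re := by
  have hF := mul_eq_one_comm.1 h.right_unitary
  have hX : Eᴴ * X * E = (Eᴴ * X * F) * (Eᴴ * F)ᴴ := by
    rw [Matrix.conjTranspose_mul, Matrix.conjTranspose_conjTranspose,
      Matrix.mul_assoc _ F, ← Matrix.mul_assoc F, hF, Matrix.one_mul]
  rw [h.left_eq, re_trace_conj_diagonal_mul, hX]
  refine Finset.sum_congr rfl fun i _ => ?_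
  rw [Matrix.mul_apply, Complex.re_sum, Finset.mul_sum]
  rfl

lemma re_trace_mul_self_conjTranspose (X : Matrix n n ℂ) :
    (ρ * (X * Xᴴ)).trace.re = ∑ i, ∑ k, a i * Complex.normSq ((Eᴴ * X * F) i k) := by
  have hF := mul_eq_one_comm.1 h.right_unitary
  have hX : Eᴴ * (X * Xᴴ) * E = (Eᴴ * X * F) * (Eᴴ * X * F)ᴴ := by
    simp only [Matrix.conjTranspose_mul, Matrix.conjTranspose_conjTranspose, Matrix.mul_assoc]
    rw [← Matrix.mul_assoc F, hF, Matrix.one_mul]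
  rw [h.left_eq, re_trace_conj_diagonal_mul, hX]
  refine Finset.sum_congr rfl fun i _ => ?_
  rw [Matrix.mul_apply, Complex.re_sum, Finset.mul_sum]
  simp [Matrix.conjTranspose_apply, Complex.normSq_apply]

lemma re_trace_mul_conjTranspose_self (X : Matrix n n ℂ) :
    (σ * (Xᴴ * X)).trace.re = ∑ i, ∑ k, b k * Complex.normSq ((Eᴴ * X * F) i k) := by
  have hE := mul_eq_one_comm.1 h.left_unitary
  have hX : Fᴴ * (Xᴴ * X) * F = (Eᴴ * X * F)ᴴ * (Eᴴ * X * F) := by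
    simp only [Matrix.conjTranspose_mul, Matrix.conjTranspose_conjTranspose, Matrix.mul_assoc]
    rw [← Matrix.mul_assoc E, hE, Matrix.one_mul]
  rw [h.right_eq, re_trace_conj_diagonal_mul, hX, Finset.sum_comm]
  refine Finset.sum_congr rfl fun i _ => ?_
  rw [Matrix.mul_apply, Complex.re_sum, Finset.mul_sum]
  simp [Matrix.conjTranspose_apply, Complex.normSq_apply]

lemma re_trace_left : ρ.trace.re = ∑ i, a i := by
  have := re_trace_conj_diagonal_mul E 1 a
  rw [← h.left_eq] at this
  simpa [h.left_unitary] using this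

lemma sum_overlap (i : n) : ∑ k, overlap E F i k = 1 := by
  have hF := mul_eq_one_comm.1 h.right_unitary
  have h1 : (Eᴴ * F) * (Eᴴ * F)ᴴ = 1 := by
    rw [Matrix.conjTranspose_mul, Matrix.conjTranspose_conjTranspose, Matrix.mul_assoc,
      ← Matrix.mul_assoc F, hF, Matrix.one_mul, h.left_unitary]
  have h2 := congrArg (fun M : Matrix n n ℂ => (M i i).re) h1
  simp only [Matrix.mul_apply (M := Eᴴ * F), Complex.re_sum, Matrix.one_apply_eq,
    Complex.one_re] at h2
  rw [← h2]
  simp [overlap, Matrix.conjTranspose_apply, Complex.normSq_apply]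

lemma sum_sum_overlap : ∑ i, ∑ k, a i * overlap E F i k = ρ.trace.re := by
  simp only [← Finset.mul_sum, h.sum_overlap, mul_one, h.re_trace_left]

lemma re_conj_right_apply (k : n) :
    ((Fᴴ * ρ * F) k k).re = ∑ i, a i * overlap E F i k := by
  have hX : Fᴴ * ρ * F = (Eᴴ * F)ᴴ * (diagonal (fun i => (a i : ℂ)) * (Eᴴ * F)) := by
    rw [h.left_eq]
    simp only [Matrix.conjTranspose_mul, Matrix.conjTranspose_conjTranspose, Matrix.mul_assoc]
  rw [hX, Matrix.mul_apply, Complex.re_sum]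
  refine Finset.sum_congr rfl fun i _ => ?_
  simp only [Matrix.conjTranspose_apply, Matrix.diagonal_mul, overlap, Complex.normSq_apply]
  simp
  ring

lemma re_conj_right_right_apply (k : n) : ((Fᴴ * σ * F) k k).re = b k := by
  have hX : Fᴴ * σ * F = (Fᴴ * F) * diagonal (fun i => (b i : ℂ)) * (Fᴴ * F) := by
    rw [h.right_eq]
    simp only [Matrix.mul_assoc]
  rw [hX, h.right_unitary]
  simp

lemma mul_overlap_le (hle : (σ - ρ).PosSemidef) (i k : n) : a i * overlap E F i k ≤ b k := by
  have h0 := (Complex.nonneg_iff.1 ((hle.conjTranspose_mul_mul_same F).diag_nonneg (i := k))).1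
  rw [Matrix.mul_sub, Matrix.sub_mul, Matrix.sub_apply, Complex.sub_re,
    h.re_conj_right_apply, h.re_conj_right_right_apply] at h0
  have h1 := Finset.single_le_sum (f := fun i => a i * overlap E F i k)
    (fun j _ => mul_nonneg (h.left_nonneg j) (Complex.normSq_nonneg _)) (Finset.mem_univ i)
  linarith

lemma two_mul_re_trace_sub_le (X : Matrix n n ℂ) {s : ℝ} (hs : 0 < s) :
    2 * (ρ * X).trace.re - (σ * (Xᴴ * X)).trace.re - s * (ρ * (X * Xᴴ)).trace.re
      ≤ ∑ i, ∑ k, a i ^ 2 * overlap E F i k / (b k + s * a i) := by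
  rw [h.re_trace_mul, h.re_trace_mul_self_conjTranspose, h.re_trace_mul_conjTranspose_self]
  simp only [Finset.mul_sum, ← Finset.sum_sub_distrib]
  refine Finset.sum_le_sum fun i _ => Finset.sum_le_sum fun k _ => ?_
  have ha := h.left_nonneg i
  have hb := h.right_nonneg k
  generalize (Eᴴ * X * F) i k = z
  rw [overlap]
  generalize (Eᴴ * F) i k = u
  rcases ha.eq_or_lt with ha0 | ha0
  · rw [← ha0]
    have := mul_nonneg hb (Complex.normSq_nonneg z)
    simp only [zero_mul, mul_zero, zero_pow two_ne_zero, zero_div]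
    linarith
  · have hd : 0 < b k + s * a i := by positivity
    rw [le_div_iff₀ hd]
    simp only [Complex.normSq_apply, Complex.star_def, Complex.mul_re, Complex.conj_re,
      Complex.conj_im]
    nlinarith [sq_nonneg ((b k + s * a i) * z.re - a i * u.re),
      sq_nonneg ((b k + s * a i) * z.im - a i * u.im)]

lemma exists_two_mul_re_trace_sub_eq {s : ℝ} (hs : 0 < s) :
    ∃ X : Matrix n n ℂ,
      2 * (ρ * X).trace.re - (σ * (Xᴴ * X)).trace.re - s * (ρ * (X * Xᴴ)).trace.re
        = ∑ i, ∑ k, a i ^ 2 * overlap E F i k / (b k + s * a i) := by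
  set Z : Matrix n n ℂ := Matrix.of fun i k => ((a i / (b k + s * a i) : ℝ) : ℂ) * (Eᴴ * F) i k
    with hZ
  have hX : Eᴴ * (E * Z * Fᴴ) * F = Z := by
    calc Eᴴ * (E * Z * Fᴴ) * F = (Eᴴ * E) * Z * (Fᴴ * F) := by simp only [Matrix.mul_assoc]
      _ = Z := by rw [h.left_unitary, h.right_unitary, Matrix.one_mul, Matrix.mul_one]
  refine ⟨E * Z * Fᴴ, ?_⟩
  rw [h.re_trace_mul, h.re_trace_mul_self_conjTranspose, h.re_trace_mul_conjTranspose_self, hX]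
  simp only [Finset.mul_sum, ← Finset.sum_sub_distrib]
  refine Finset.sum_congr rfl fun i _ => Finset.sum_congr rfl fun k _ => ?_
  have ha := h.left_nonneg i
  have hb := h.right_nonneg k
  rw [overlap, hZ, Matrix.of_apply]
  generalize (Eᴴ * F) i k = u
  rcases ha.eq_or_lt with ha0 | ha0
  · simp [← ha0]
  · have hd : b k + s * a i ≠ 0 := by positivity
    simp only [Complex.normSq_apply, Complex.star_def, Complex.mul_re, Complex.mul_im,
      Complex.conj_re, Complex.conj_im, Complex.ofReal_re, Complex.ofReal_im]
    field_simp
    ring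

lemma sum_resolvent_eq {s : ℝ} (hs : 0 < s) :
    ∑ ik : n × n, a ik.1 * overlap E F ik.1 ik.2 / (b ik.2 / a ik.1 + s)
      = ∑ i, ∑ k, a i ^ 2 * overlap E F i k / (b k + s * a i) := by
  rw [Fintype.sum_prod_type]
  refine Finset.sum_congr rfl fun i _ => Finset.sum_congr rfl fun k _ => ?_
  have hb := h.right_nonneg k
  rcases (h.left_nonneg i).eq_or_lt with ha0 | ha0
  · simp [← ha0]
  · have hd : b k + s * a i ≠ 0 := by positivity
    have hd' : b k + a i * s ≠ 0 := by positivity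
    field_simp

lemma right_div_left_pos (hle : (σ - ρ).PosSemidef) (i k : n)
    (hne : a i * overlap E F i k ≠ 0) : 0 < b k / a i := by
  have hpos : 0 < a i * overlap E F i k :=
    lt_of_le_of_ne (mul_nonneg (h.left_nonneg i) (Complex.normSq_nonneg _)) hne.symm
  exact div_pos (hpos.trans_le (h.mul_overlap_le hle i k))
    ((h.left_nonneg i).lt_of_ne (left_ne_zero_of_mul hne).symm)

lemma sum_mul_neg_log_eq (hle : (σ - ρ).PosSemidef) :
    ∑ ik : n × n, a ik.1 * overlap E F ik.1 ik.2 * -Real.log (b ik.2 / a ik.1)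
      = ∑ i, a i * Real.log (a i) - ∑ k, ((Fᴴ * ρ * F) k k).re * Real.log (b k) := by
  have h1 : ∑ i, a i * Real.log (a i)
      = ∑ i, ∑ k, a i * overlap E F i k * Real.log (a i) := by
    simp only [← Finset.sum_mul, ← Finset.mul_sum, h.sum_overlap, mul_one]
  have h2 : ∑ k, ((Fᴴ * ρ * F) k k).re * Real.log (b k)
      = ∑ i, ∑ k, a i * overlap E F i k * Real.log (b k) := by
    rw [Finset.sum_comm]
    simp only [h.re_conj_right_apply, Finset.sum_mul]
  rw [h1, h2, Fintype.sum_prod_type]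
  simp only [← Finset.sum_sub_distrib]
  refine Finset.sum_congr rfl fun i _ => Finset.sum_congr rfl fun k _ => ?_
  by_cases hne : a i * overlap E F i k = 0
  · simp [hne]
  · have hb : b k ≠ 0 := fun h0 => by
      have := h.right_div_left_pos hle i k hne
      simp [h0] at this
    rw [Real.log_div hb (left_ne_zero_of_mul hne)]
    ring

/-- For `ρ ≤ σ` the relative entropy of `ρ` with respect to `σ` is nonpositive. -/
lemma relEntropy_nonpos (hρ : ρ.PosSemidef) (hle : (σ - ρ).PosSemidef) :
    ∑ i, a i * Real.log (a i) - ∑ k, ((Fᴴ * ρ * F) k k).re * Real.log (b k) ≤ 0 := by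
  rw [← h.sum_mul_neg_log_eq hle]
  have key := sum_mul_neg_log_le_of_resolvent_le (fun _ : Unit => ρ.trace.re) (fun _ => 1)
    (fun ik : n × n => a ik.1 * overlap E F ik.1 ik.2) (fun ik => b ik.2 / a ik.1)
    (fun _ => zero_le_one) (fun ik => div_nonneg (h.right_nonneg _) (h.left_nonneg _))
    (fun _ _ => zero_lt_one) (fun ik => h.right_div_left_pos hle ik.1 ik.2)
    (by simp [Fintype.sum_prod_type, h.sum_sum_overlap])
  refine (key fun s hs => ?_).trans (by simp)
  rw [h.sum_resolvent_eq hs]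
  obtain ⟨X, hX⟩ := h.exists_two_mul_re_trace_sub_eq hs
  rw [← hX]
  have hXX := hle.re_trace_mul_nonneg (posSemidef_conjTranspose_mul_self X)
  rw [Matrix.sub_mul, Matrix.trace_sub, Complex.sub_re] at hXX
  set c : ℝ := 1 / (1 + s) with hc
  have hadj : (ρ * Xᴴ).trace.re = (ρ * X).trace.re := by
    rw [← hρ.1.eq, ← Matrix.conjTranspose_mul, Matrix.trace_conjTranspose,
      Matrix.trace_mul_comm X, hρ.1.eq]
    simp
  have hl := hρ.re_trace_mul_nonneg (posSemidef_conjTranspose_mul_self (X - (c : ℂ) • 1))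
  have hr := hρ.re_trace_mul_nonneg (posSemidef_self_mul_conjTranspose (X - (c : ℂ) • 1))
  simp only [Matrix.conjTranspose_sub, Matrix.conjTranspose_smul, Matrix.conjTranspose_one,
    Matrix.mul_sub, Matrix.sub_mul, Matrix.mul_smul, Matrix.smul_mul, Matrix.mul_one,
    Matrix.one_mul, Matrix.trace_sub, Matrix.trace_smul, Complex.sub_re, smul_eq_mul,
    Complex.star_def, Complex.conj_ofReal, Complex.re_ofReal_mul, hadj] at hl hr
  have hcs : c * (1 + s) = 1 := by rw [hc]; field_simp
  have hgoal : ∑ _j : Unit, ρ.trace.re / (1 + s) = c * ρ.trace.re := by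
    simp only [Finset.univ_unique, Finset.sum_singleton, hc]; ring
  rw [hgoal]
  have hsr := mul_nonneg hs.le hr
  have e1 : c * (c * ρ.trace.re) * (1 + s) = c * ρ.trace.re := by
    linear_combination (c * ρ.trace.re) * hcs
  have e2 : c * (ρ * X).trace.re * (1 + s) = (ρ * X).trace.re := by
    linear_combination ((ρ * X).trace.re) * hcs
  nlinarith

/-- Monotonicity of the relative entropy under a measurement. -/
lemma measured_relEntropy_le {Ω : Type*} [Fintype Ω] (hρ : ρ.PosSemidef) (hσ : σ.PosSemidef)
    (hle : (σ - ρ).PosSemidef) (Y : Ω → Matrix n n ℂ) (hY : ∀ j, (Y j).PosSemidef)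
    (hsum : ∑ j, Y j = 1) :
    ∑ j, (ρ * Y j).trace.re * (Real.log (ρ * Y j).trace.re - Real.log (σ * Y j).trace.re)
      ≤ ∑ i, a i * Real.log (a i) - ∑ k, ((Fᴴ * ρ * F) k k).re * Real.log (b k) := by
  rw [← h.sum_mul_neg_log_eq hle]
  set p : Ω → ℝ := fun j => (ρ * Y j).trace.re with hp
  set q : Ω → ℝ := fun j => (σ * Y j).trace.re with hq
  have hp0 : ∀ j, 0 ≤ p j := fun j => hρ.re_trace_mul_nonneg (hY j)
  have hq0 : ∀ j, 0 ≤ q j := fun j => hσ.re_trace_mul_nonneg (hY j)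
  have hpq : ∀ j, p j ≤ q j := fun j => by
    have := hle.re_trace_mul_nonneg (hY j)
    rw [Matrix.sub_mul, Matrix.trace_sub, Complex.sub_re] at this
    exact sub_nonneg.1 this
  have hppos : ∀ j, p j ≠ 0 → 0 < p j := fun j hj => lt_of_le_of_ne (hp0 j) hj.symm
  have hpsum : ∑ j, p j = ρ.trace.re := by
    rw [hp, ← Complex.re_sum, ← Matrix.trace_sum, ← Finset.mul_sum, hsum, Matrix.mul_one]
  have key := sum_mul_neg_log_le_of_resolvent_le
    (fun ik : n × n => a ik.1 * overlap E F ik.1 ik.2) (fun ik => b ik.2 / a ik.1)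
    p (fun j => q j / p j)
    (fun ik => div_nonneg (h.right_nonneg _) (h.left_nonneg _))
    (fun j => div_nonneg (hq0 j) (hp0 j))
    (fun ik => h.right_div_left_pos hle ik.1 ik.2)
    (fun j hj => div_pos ((hppos j hj).trans_le (hpq j)) (hppos j hj))
    (by simp only [Fintype.sum_prod_type, h.sum_sum_overlap, hpsum])
  refine le_trans (le_of_eq ?_) (key fun s hs => ?_)
  · refine Finset.sum_congr rfl fun j _ => ?_
    change p j * (Real.log (p j) - Real.log (q j)) = _
    by_cases hj : p j = 0
    · simp [hj]
    · have hqj : q j ≠ 0 := ((hppos j hj).trans_le (hpq j)).ne'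
      rw [Real.log_div hqj hj]
      ring
  · rw [h.sum_resolvent_eq hs]
    set c : Ω → ℝ := fun j => p j / (q j + s * p j) with hc
    set X : Matrix n n ℂ := ∑ j, (c j : ℂ) • Y j with hX
    have hXh : Xᴴ = X := by
      rw [hX, Matrix.conjTranspose_sum]
      exact Finset.sum_congr rfl fun j _ => by simp [(hY j).1.eq]
    have hdev : (∑ j, ((c j : ℂ) ^ 2) • Y j - X * X).PosSemidef := by
      have hexp : ∑ j, ((c j : ℂ) ^ 2) • Y j - X * X
          = ∑ j, ((c j : ℂ) • 1 - X)ᴴ * Y j * ((c j : ℂ) • 1 - X) := by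
        have hterm : ∀ j, ((c j : ℂ) • 1 - X)ᴴ * Y j * ((c j : ℂ) • 1 - X)
            = ((c j : ℂ) ^ 2) • Y j - ((c j : ℂ) • Y j) * X - X * ((c j : ℂ) • Y j)
              + X * Y j * X := by
          intro j
          simp only [Matrix.conjTranspose_sub, Matrix.conjTranspose_smul,
            Matrix.conjTranspose_one, hXh, Complex.star_def, Complex.conj_ofReal,
            Matrix.sub_mul, Matrix.mul_sub, Matrix.smul_mul, Matrix.mul_smul, Matrix.one_mul,
            Matrix.mul_one, smul_sub, pow_two, mul_smul]
          abel
        simp only [hterm, Finset.sum_add_distrib, Finset.sum_sub_distrib, ← Finset.sum_mul,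
          ← Finset.mul_sum, hsum, ← hX, Matrix.mul_one]
        abel
      rw [hexp]
      exact Matrix.posSemidef_sum _ fun j _ => (hY j).conjTranspose_mul_mul_same _
    have hbound : ∀ τ : Matrix n n ℂ, τ.PosSemidef →
        (τ * (X * X)).trace.re ≤ ∑ j, c j ^ 2 * (τ * Y j).trace.re := by
      intro τ hτ
      have := hτ.re_trace_mul_nonneg hdev
      rw [Matrix.mul_sub, Matrix.trace_sub, Complex.sub_re, Finset.mul_sum, Matrix.trace_sum,
        Complex.re_sum] at this
      simp only [Matrix.mul_smul, Matrix.trace_smul, smul_eq_mul, ← Complex.ofReal_pow,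
        Complex.re_ofReal_mul] at this
      linarith
    have hlin : (ρ * X).trace.re = ∑ j, c j * p j := by
      rw [hX, Finset.mul_sum, Matrix.trace_sum, Complex.re_sum]
      simp only [Matrix.mul_smul, Matrix.trace_smul, smul_eq_mul, Complex.re_ofReal_mul, hp]
    have hvar := h.two_mul_re_trace_sub_le X hs
    rw [hXh, hlin] at hvar
    have hb1 := hbound σ hσ
    have hb2 := mul_le_mul_of_nonneg_left (hbound ρ hρ) hs.le
    have hval : ∑ j, p j / (q j / p j + s)
        = 2 * ∑ j, c j * p j - ∑ j, c j ^ 2 * q j - s * ∑ j, c j ^ 2 * p j := by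
      simp only [Finset.mul_sum, ← Finset.sum_sub_distrib]
      refine Finset.sum_congr rfl fun j _ => ?_
      by_cases hj : p j = 0
      · simp [hj, hc]
      · have hpj := hppos j hj
        have hqj := hpj.trans_le (hpq j)
        have hd : q j + s * p j ≠ 0 := by positivity
        have hd' : q j + p j * s ≠ 0 := by positivity
        simp only [hc]
        field_simp
        ring
    rw [hval]
    linarith

end SpectralPair

end SpectralForms

lemma negMulLogb_eq (x : ℝ) : negMulLogb x = -(x * Real.log x) / Real.log 2 := by
  rw [negMulLogb, Real.logb]
  ring

lemma Matrix.IsHermitian.eq_conj_diagonal {n : Type*} [Fintype n] [DecidableEq n]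
    {A : Matrix n n ℂ} (hA : A.IsHermitian) :
    A = (hA.eigenvectorUnitary : Matrix n n ℂ) * diagonal (fun i => (hA.eigenvalues i : ℂ)) *
      (hA.eigenvectorUnitary : Matrix n n ℂ)ᴴ :=
  hA.spectral_theorem

lemma sum_eigenvalues_eq_one {n : Type*} [Fintype n] [DecidableEq n] {A : Matrix n n ℂ}
    (hA : MatState A) : ∑ i, hA.1.1.eigenvalues i = 1 := by
  rw [← Complex.ofReal_inj, Complex.ofReal_sum, Complex.ofReal_one]
  exact hA.1.1.trace_eq_sum_eigenvalues.symm.trans hA.2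

lemma mul_log_mul_eq (x y : ℝ) :
    (x * y) * Real.log (x * y) = y * (x * Real.log x) + x * (y * Real.log y) := by
  have := Real.negMulLog_mul x y
  simp only [Real.negMulLog] at this
  linarith

/-- Holevo bound: the classical mutual information extracted by any
POVM measurement `Y` from the ensemble `(P, W)` is at most the Holevo quantity
`χ(P,W)`, which in turn is at most the Shannon entropy of `P`. -/
theorem holevo_bound {n : ℕ} {𝒳 Ω : Type} [Fintype 𝒳] [Fintype Ω]
    (P : 𝒳 → ℝ) (hP : ∀ x, 0 ≤ P x) (hPsum : ∑ x, P x = 1)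
    (W : 𝒳 → Matrix (Fin n) (Fin n) ℂ) (hW : ∀ x, MatState (W x))
    (Y : Ω → Matrix (Fin n) (Fin n) ℂ)
    (hYpos : ∀ j, (Y j).PosSemidef) (hYsum : ∑ j, Y j = 1) :
    mutualInfo (fun x j => P x * ((W x * Y j).trace).re) ≤
      vnEntropy (∑ x, (P x : ℂ) • W x) - ∑ x, P x * vnEntropy (W x) ∧
    vnEntropy (∑ x, (P x : ℂ) • W x) - ∑ x, P x * vnEntropy (W x) ≤
      shannonEntropy P := by
  set σ : Matrix (Fin n) (Fin n) ℂ := ∑ x, (P x : ℂ) • W x with hσdef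
  set ρ : 𝒳 → Matrix (Fin n) (Fin n) ℂ := fun x => (P x : ℂ) • W x with hρdef
  have hρ : ∀ x, (ρ x).PosSemidef := fun x =>
    (hW x).1.smul (by exact_mod_cast hP x : (0 : ℂ) ≤ (P x : ℂ))
  have hσ : σ.PosSemidef := Matrix.posSemidef_sum _ fun x _ => hρ x
  have hle : ∀ x, (σ - ρ x).PosSemidef := by
    classical
    intro x
    rw [hσdef, ← Finset.sum_erase_add _ _ (Finset.mem_univ x), add_sub_cancel_right]
    exact Matrix.posSemidef_sum _ fun y _ => hρ y
  set w : 𝒳 → Fin n → ℝ := fun x => (hW x).1.1.eigenvalues with hw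
  set b : Fin n → ℝ := hσ.1.eigenvalues with hb
  set F : Matrix (Fin n) (Fin n) ℂ := ↑hσ.1.eigenvectorUnitary with hF
  have hpair : ∀ x, SpectralPair (ρ x) σ ((hW x).1.1.eigenvectorUnitary : Matrix _ _ ℂ) F
      (fun i => P x * w x i) b := fun x =>
    { left_unitary := Unitary.coe_star_mul_self _
      right_unitary := Unitary.coe_star_mul_self _
      left_eq := by
        have hdiag : diagonal (fun i => ((P x * w x i : ℝ) : ℂ))
            = (P x : ℂ) • diagonal (fun i => (w x i : ℂ)) := by
          rw [← Matrix.diagonal_smul]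
          congr 1
          ext i
          simp
        rw [hdiag, Matrix.mul_smul, Matrix.smul_mul]
        exact congrArg (fun M => (P x : ℂ) • M) (hW x).1.1.eq_conj_diagonal
      right_eq := hσ.1.eq_conj_diagonal
      left_nonneg := fun i => mul_nonneg (hP x) ((hW x).1.eigenvalues_nonneg i)
      right_nonneg := hσ.eigenvalues_nonneg }
  set D : 𝒳 → ℝ := fun x => ∑ i, (P x * w x i) * Real.log (P x * w x i)
    - ∑ k, ((Fᴴ * ρ x * F) k k).re * Real.log (b k) with hD
  have hDnonpos : ∀ x, D x ≤ 0 := fun x => (hpair x).relEntropy_nonpos (hρ x) (hle x)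
  have hDmeas := fun x => (hpair x).measured_relEntropy_le (hρ x) hσ (hle x) Y hYpos hYsum
  have hlog2 : 0 < Real.log 2 := Real.log_pos one_lt_two
  have hdiagσ : ∑ x, ∑ k, ((Fᴴ * ρ x * F) k k).re * Real.log (b k)
      = ∑ k, b k * Real.log (b k) := by
    rw [Finset.sum_comm]
    refine Finset.sum_congr rfl fun k _ => ?_
    have hexp : Fᴴ * σ * F = ∑ x, Fᴴ * ρ x * F := by
      rw [hσdef, Finset.mul_sum, Finset.sum_mul]
    have hbk : b k = ∑ x, ((Fᴴ * ρ x * F) k k).re := by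
      have hx : Nonempty 𝒳 := by
        by_contra hne
        rw [not_nonempty_iff] at hne
        simp at hPsum
      rw [← (hpair hx.some).re_conj_right_right_apply k, hexp, Matrix.sum_apply, Complex.re_sum]
    rw [← Finset.sum_mul, ← hbk]
  have hχ : vnEntropy σ - ∑ x, P x * vnEntropy (W x)
      = (-∑ x, P x * Real.log (P x) + ∑ x, D x) / Real.log 2 := by
    have h1 : ∀ x, vnEntropy (W x) = -(∑ i, w x i * Real.log (w x i)) / Real.log 2 := fun x => by
      rw [vnEntropy, dif_pos (hW x).1.1]
      simp only [negMulLogb_eq, ← Finset.sum_div, Finset.sum_neg_distrib, hw]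
    have h2 : vnEntropy σ = -(∑ k, b k * Real.log (b k)) / Real.log 2 := by
      rw [vnEntropy, dif_pos hσ.1]
      simp only [negMulLogb_eq, ← Finset.sum_div, Finset.sum_neg_distrib, hb]
    have h3 : ∀ x, ∑ i, (P x * w x i) * Real.log (P x * w x i)
        = P x * Real.log (P x) + P x * ∑ i, w x i * Real.log (w x i) := fun x => by
      simp only [mul_log_mul_eq, Finset.sum_add_distrib, ← Finset.sum_mul, ← Finset.mul_sum]
      rw [hw, sum_eigenvalues_eq_one (hW x), one_mul]
    have h4 : ∑ x, D x = ∑ x, P x * Real.log (P x)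
        + ∑ x, P x * ∑ i, w x i * Real.log (w x i) - ∑ k, b k * Real.log (b k) := by
      simp only [hD, Finset.sum_sub_distrib, hdiagσ, h3, Finset.sum_add_distrib]
    have h5 : ∑ x, P x * vnEntropy (W x)
        = -(∑ x, P x * ∑ i, w x i * Real.log (w x i)) / Real.log 2 := by
      rw [← Finset.sum_neg_distrib, Finset.sum_div]
      refine Finset.sum_congr rfl fun x _ => ?_
      rw [h1]
      ring
    rw [h2, h5, h4]
    ring
  have hH : shannonEntropy P = (-∑ x, P x * Real.log (P x)) / Real.log 2 := by
    simp only [shannonEntropy, negMulLogb_eq, ← Finset.sum_div, Finset.sum_neg_distrib]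
  have hI : mutualInfo (fun x j => P x * ((W x * Y j).trace).re)
      = (-∑ x, P x * Real.log (P x) + ∑ x, ∑ j, (ρ x * Y j).trace.re *
        (Real.log (ρ x * Y j).trace.re - Real.log (σ * Y j).trace.re)) / Real.log 2 := by
    have hp : ∀ x j, P x * ((W x * Y j).trace).re = (ρ x * Y j).trace.re := fun x j => by
      rw [hρdef, Matrix.smul_mul, Matrix.trace_smul, smul_eq_mul, Complex.re_ofReal_mul]
    have hrow : ∀ x, ∑ j, (ρ x * Y j).trace.re = P x := fun x => by
      rw [← Complex.re_sum, ← Matrix.trace_sum, ← Finset.mul_sum, hYsum, Matrix.mul_one, hρdef,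
        Matrix.trace_smul, (hW x).2]
      simp
    have hcol : ∀ j, ∑ x, (ρ x * Y j).trace.re = (σ * Y j).trace.re := fun j => by
      rw [← Complex.re_sum, ← Matrix.trace_sum, ← Finset.sum_mul]
    have hcross : ∑ x, ∑ j, (ρ x * Y j).trace.re * Real.log (σ * Y j).trace.re
        = ∑ j, (σ * Y j).trace.re * Real.log (σ * Y j).trace.re := by
      rw [Finset.sum_comm]
      simp only [← Finset.sum_mul, hcol]
    simp only [mutualInfo, hp, hrow, hcol, shannonEntropy, negMulLogb_eq, ← Finset.sum_div,
      Finset.sum_neg_distrib, Fintype.sum_prod_type, mul_sub, Finset.sum_sub_distrib, hcross]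
    ring
  rw [hI, hχ, hH]
  constructor
  · gcongr
    exact hDmeas _
  · gcongr
    linarith [Finset.sum_nonpos fun x (_ : x ∈ Finset.univ) => hDnonpos x]
end

section
/- Let 𝒳 be a finite set, P a probability distribution on 𝒳, (W_x)_{x∈𝒳} a family of density matrices on M_n(ℂ), and Φ a quantum channel from M_n(ℂ) to M_m(ℂ). Then χ(P, Φ∘W) ≤ χ(P, W), i.e. H(Σ_x P(x) Φ(W_x)) − Σ_x P(x) H(Φ(W_x)) ≤ H(Σ_x P(x) W_x) − Σ_x P(x) H(W_x). (Monotonicity of the Holevo quantity under quantum operations.) -/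
open scoped ComplexOrder Kronecker
open Matrix

section Scalar

theorem hasDerivAt_segment_sub_mul_log {p q s : ℝ} (hp : 0 ≤ p) (hq : 0 ≤ q)
    (hpq : q = 0 → p = 0) (hs : s ∈ Set.Ioo (0 : ℝ) 1) :
    HasDerivAt (fun t : ℝ => ((1 - t) * p + t * q) - p * Real.log ((1 - t) * p + t * q))
      (s * ((p - q) ^ 2 / ((1 - s) * p + s * q))) s := by
  obtain ⟨hs0, hs1⟩ := hs
  have hu : HasDerivAt (fun t : ℝ => (1 - t) * p + t * q) (q - p) s := by
    have h := (((hasDerivAt_id s).const_sub 1).mul_const p).add ((hasDerivAt_id s).mul_const q)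
    exact h.congr_deriv (by ring)
  rcases hp.eq_or_lt with rfl | hp
  · rcases hq.eq_or_lt with rfl | hq
    · simpa using hasDerivAt_const s (0 : ℝ)
    · have he : s * ((0 - q) ^ 2 / ((1 - s) * 0 + s * q)) = q - 0 := by
        field_simp
        ring
      rw [he]
      simpa using hu
  · have hq : 0 < q := lt_of_le_of_ne hq fun h => hp.ne' (hpq h.symm)
    have hpos : 0 < (1 - s) * p + s * q :=
      add_pos (mul_pos (by linarith) hp) (mul_pos hs0 hq)
    refine (hu.sub ((hu.log hpos.ne').const_mul p)).congr_deriv ?_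
    field_simp
    ring

theorem continuousOn_segment_sub_mul_log {p q : ℝ} (hp : 0 ≤ p) (hq : 0 ≤ q)
    (hpq : q = 0 → p = 0) :
    ContinuousOn (fun t : ℝ => ((1 - t) * p + t * q) - p * Real.log ((1 - t) * p + t * q))
      (Set.Icc 0 1) := by
  rcases hp.eq_or_lt with rfl | hp
  · simp only [zero_mul, sub_zero]
    fun_prop
  · have hq : 0 < q := lt_of_le_of_ne hq fun h => hp.ne' (hpq h.symm)
    refine ContinuousOn.sub (by fun_prop)
      (continuousOn_const.mul (ContinuousOn.log (by fun_prop) fun t ht => ?_))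
    rcases ht.1.eq_or_lt with rfl | ht0
    · simpa using hp.ne'
    · exact (add_pos_of_nonneg_of_pos (mul_nonneg (by linarith [ht.2]) hp.le)
        (mul_pos ht0 hq)).ne'

theorem two_mul_re_conj_mul_sub_le {a u : ℝ} (hu : 0 ≤ u) (hau : u = 0 → a = 0) (y z : ℂ) :
    2 * (star y * ((a : ℂ) * z)).re - u * Complex.normSq y ≤ Complex.normSq z * (a ^ 2 / u) := by
  rcases hu.eq_or_lt with rfl | hu
  · simp [hau rfl]
  · rw [mul_div_assoc', le_div_iff₀ hu]
    simp only [Complex.normSq_apply, Complex.star_def, Complex.mul_re, Complex.mul_im,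
      Complex.conj_re, Complex.conj_im, Complex.ofReal_re, Complex.ofReal_im]
    nlinarith [sq_nonneg (u * y.re - a * z.re), sq_nonneg (u * y.im - a * z.im)]

theorem two_mul_re_conj_mul_sub_eq {a u : ℝ} (hau : u = 0 → a = 0) (z : ℂ) :
    2 * (star (((a / u : ℝ) : ℂ) * z) * ((a : ℂ) * z)).re
      - u * Complex.normSq (((a / u : ℝ) : ℂ) * z) = Complex.normSq z * (a ^ 2 / u) := by
  rcases eq_or_ne u 0 with rfl | hu
  · simp [hau rfl]
  · simp only [Complex.normSq_apply, Complex.star_def, Complex.mul_re, Complex.mul_im,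
      Complex.conj_re, Complex.conj_im, Complex.ofReal_re, Complex.ofReal_im]
    field_simp
    ring

theorem segment_eq_zero {p q s : ℝ} (hp : 0 ≤ p) (hq : 0 ≤ q) (hs : s ∈ Set.Ioo (0 : ℝ) 1)
    (h : (1 - s) * p + s * q = 0) : p - q = 0 := by
  obtain ⟨hs0, hs1⟩ := hs
  have h1 : 0 < 1 - s := by linarith
  have h2 := (add_eq_zero_iff_of_nonneg (mul_nonneg h1.le hp) (mul_nonneg hs0.le hq)).1 h
  have h3 := (mul_eq_zero.1 h2.1).resolve_left h1.ne'
  have h4 := (mul_eq_zero.1 h2.2).resolve_left hs0.ne'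
  rw [h3, h4, sub_zero]

end Scalar

section Variational

variable {ι : Type*} [Fintype ι]

/-- The concave functional of `X` whose supremum is the quasi-entropy of `ρ` and `σ`. -/
noncomputable def quasiForm (s : ℝ) (ρ σ X : Matrix ι ι ℂ) : ℝ :=
  2 * (Xᴴ * (ρ - σ)).trace.re - (1 - s) * (Xᴴ * ρ * X).trace.re - s * (X * σ * Xᴴ).trace.re

/-- The quasi-entropy in terms of eigenvalues `p`, `q` and the matrix `M` of overlaps of the
eigenvectors. -/
noncomputable def quasiEntropy (s : ℝ) (p q : ι → ℝ) (M : Matrix ι ι ℂ) : ℝ :=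
  ∑ i, ∑ j, Complex.normSq (M i j) * ((p i - q j) ^ 2 / ((1 - s) * p i + s * q j))

/-- An antiderivative of `s * quasiEntropy s p q M` in `s`. -/
noncomputable def quasiPrimitive (p q : ι → ℝ) (M : Matrix ι ι ℂ) (s : ℝ) : ℝ :=
  ∑ i, ∑ j, Complex.normSq (M i j) * (((1 - s) * p i + s * q j)
    - p i * Real.log ((1 - s) * p i + s * q j))

theorem hasDerivAt_quasiPrimitive {p q : ι → ℝ} {M : Matrix ι ι ℂ} (hp : 0 ≤ p) (hq : 0 ≤ q)
    (hpq : ∀ i j, q j = 0 → Complex.normSq (M i j) * p i = 0) {s : ℝ}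
    (hs : s ∈ Set.Ioo (0 : ℝ) 1) :
    HasDerivAt (quasiPrimitive p q M) (s * quasiEntropy s p q M) s := by
  simp only [quasiEntropy, Finset.mul_sum]
  refine HasDerivAt.fun_sum fun i _ => HasDerivAt.fun_sum fun j _ => ?_
  by_cases hc : Complex.normSq (M i j) = 0
  · simpa [hc] using hasDerivAt_const s (0 : ℝ)
  · rw [mul_left_comm]
    exact (hasDerivAt_segment_sub_mul_log (hp i) (hq j)
      (fun h => (mul_eq_zero.1 (hpq i j h)).resolve_left hc) hs).const_mul _

theorem continuousOn_quasiPrimitive {p q : ι → ℝ} {M : Matrix ι ι ℂ} (hp : 0 ≤ p) (hq : 0 ≤ q)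
    (hpq : ∀ i j, q j = 0 → Complex.normSq (M i j) * p i = 0) :
    ContinuousOn (quasiPrimitive p q M) (Set.Icc 0 1) := by
  refine continuousOn_finsetSum _ fun i _ => continuousOn_finsetSum _ fun j _ => ?_
  by_cases hc : Complex.normSq (M i j) = 0
  · simpa [hc] using continuousOn_const
  · exact continuousOn_const.mul (continuousOn_segment_sub_mul_log (hp i) (hq j)
      (fun h => (mul_eq_zero.1 (hpq i j h)).resolve_left hc))

variable [DecidableEq ι]

theorem quasiForm_spectral (s : ℝ) (p q : ι → ℝ) {U V : Matrix ι ι ℂ}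
    (hU : Uᴴ * U = 1) (hV : Vᴴ * V = 1) (Y : Matrix ι ι ℂ) :
    quasiForm s (U * diagonal (fun i => (p i : ℂ)) * Uᴴ) (V * diagonal (fun i => (q i : ℂ)) * Vᴴ)
      (U * Y * Vᴴ) =
    ∑ i, ∑ j, (2 * (star (Y i j) * (((p i - q j : ℝ) : ℂ) * (Uᴴ * V) i j)).re
      - ((1 - s) * p i + s * q j) * Complex.normSq (Y i j)) := by
  have hU' (B : Matrix ι ι ℂ) : Uᴴ * (U * B) = B := by rw [← mul_assoc, hU, one_mul]
  have hV' (B : Matrix ι ι ℂ) : Vᴴ * (V * B) = B := by rw [← mul_assoc, hV, one_mul]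
  set P := diagonal (fun i => (p i : ℂ)) with hP
  set Q := diagonal (fun i => (q i : ℂ)) with hQ
  have h1 : ((U * Y * Vᴴ)ᴴ * (U * P * Uᴴ - V * Q * Vᴴ)).trace =
      ∑ i, ∑ j, star (Y i j) * (((p i - q j : ℝ) : ℂ) * (Uᴴ * V) i j) := by
    have e1 : ((U * Y * Vᴴ)ᴴ * (U * P * Uᴴ - V * Q * Vᴴ)).trace =
        (Yᴴ * (P * (Uᴴ * V) - (Uᴴ * V) * Q)).trace := by
      simp only [conjTranspose_mul, conjTranspose_conjTranspose, mul_sub, mul_assoc, hU',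
        trace_sub]
      rw [trace_mul_comm V, trace_mul_comm V]
      simp only [mul_assoc, hV, mul_one]
    rw [e1, trace, Finset.sum_comm]
    refine Finset.sum_congr rfl fun j _ => ?_
    rw [diag_apply, mul_apply]
    refine Finset.sum_congr rfl fun i _ => ?_
    simp only [conjTranspose_apply, Matrix.sub_apply, hP, hQ, diagonal_mul, mul_diagonal]
    push_cast
    ring
  have h2 : ((U * Y * Vᴴ)ᴴ * (U * P * Uᴴ) * (U * Y * Vᴴ)).trace =
      ∑ i, ∑ j, ((p i * Complex.normSq (Y i j) : ℝ) : ℂ) := by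
    have e1 : ((U * Y * Vᴴ)ᴴ * (U * P * Uᴴ) * (U * Y * Vᴴ)).trace = (Yᴴ * (P * Y)).trace := by
      simp only [conjTranspose_mul, conjTranspose_conjTranspose, mul_assoc, hU']
      rw [trace_mul_comm V]
      simp only [mul_assoc, hV, mul_one]
    rw [e1, trace, Finset.sum_comm]
    refine Finset.sum_congr rfl fun j _ => ?_
    rw [diag_apply, mul_apply]
    refine Finset.sum_congr rfl fun i _ => ?_
    simp only [conjTranspose_apply, hP, diagonal_mul]
    push_cast
    rw [Complex.normSq_eq_conj_mul_self, Complex.star_def]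
    ring
  have h3 : ((U * Y * Vᴴ) * (V * Q * Vᴴ) * (U * Y * Vᴴ)ᴴ).trace =
      ∑ i, ∑ j, ((q j * Complex.normSq (Y i j) : ℝ) : ℂ) := by
    have e1 : ((U * Y * Vᴴ) * (V * Q * Vᴴ) * (U * Y * Vᴴ)ᴴ).trace = (Y * (Q * Yᴴ)).trace := by
      simp only [conjTranspose_mul, conjTranspose_conjTranspose, mul_assoc, hV']
      rw [trace_mul_comm U]
      simp only [mul_assoc, hU, mul_one]
    rw [e1, trace]
    refine Finset.sum_congr rfl fun i _ => ?_
    rw [diag_apply, mul_apply]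
    refine Finset.sum_congr rfl fun j _ => ?_
    simp only [conjTranspose_apply, hQ, diagonal_mul]
    push_cast
    rw [Complex.normSq_eq_conj_mul_self, Complex.star_def]
    ring
  rw [quasiForm, h1, h2, h3]
  simp only [Complex.re_sum, Complex.ofReal_re, Finset.mul_sum, ← Finset.sum_sub_distrib]
  refine Finset.sum_congr rfl fun i _ => Finset.sum_congr rfl fun j _ => ?_
  ring

theorem quasiForm_le_quasiEntropy {s : ℝ} (hs : s ∈ Set.Ioo (0 : ℝ) 1) {p q : ι → ℝ}
    (hp : 0 ≤ p) (hq : 0 ≤ q) {U V : Matrix ι ι ℂ} (hU : Uᴴ * U = 1) (hV : Vᴴ * V = 1)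
    (X : Matrix ι ι ℂ) :
    quasiForm s (U * diagonal (fun i => (p i : ℂ)) * Uᴴ)
      (V * diagonal (fun i => (q i : ℂ)) * Vᴴ) X ≤ quasiEntropy s p q (Uᴴ * V) := by
  have hX : X = U * (Uᴴ * X * V) * Vᴴ := by
    rw [show U * (Uᴴ * X * V) * Vᴴ = (U * Uᴴ) * X * (V * Vᴴ) by simp only [mul_assoc],
      mul_eq_one_comm.1 hU, mul_eq_one_comm.1 hV, one_mul, mul_one]
  rw [hX, quasiForm_spectral s p q hU hV]
  refine Finset.sum_le_sum fun i _ => Finset.sum_le_sum fun j _ => ?_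
  exact two_mul_re_conj_mul_sub_le
    (add_nonneg (mul_nonneg (by linarith [hs.2]) (hp i)) (mul_nonneg hs.1.le (hq j)))
    (segment_eq_zero (hp i) (hq j) hs) _ _

theorem exists_quasiForm_eq_quasiEntropy {s : ℝ} (hs : s ∈ Set.Ioo (0 : ℝ) 1) {p q : ι → ℝ}
    (hp : 0 ≤ p) (hq : 0 ≤ q) {U V : Matrix ι ι ℂ} (hU : Uᴴ * U = 1) (hV : Vᴴ * V = 1) :
    ∃ X, quasiForm s (U * diagonal (fun i => (p i : ℂ)) * Uᴴ)
      (V * diagonal (fun i => (q i : ℂ)) * Vᴴ) X = quasiEntropy s p q (Uᴴ * V) := by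
  refine ⟨U * (of fun i j =>
    (((p i - q j) / ((1 - s) * p i + s * q j) : ℝ) : ℂ) * (Uᴴ * V) i j) * Vᴴ, ?_⟩
  rw [quasiForm_spectral s p q hU hV]
  refine Finset.sum_congr rfl fun i _ => Finset.sum_congr rfl fun j _ => ?_
  exact two_mul_re_conj_mul_sub_eq (segment_eq_zero (hp i) (hq j) hs) _

end Variational

section Channel

variable {ι ι' κ : Type*} [Fintype κ]

/-- The map with Kraus operators `A`. -/
noncomputable def krausMap [Fintype ι] (A : κ → Matrix ι' ι ℂ) (ρ : Matrix ι ι ℂ) :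
    Matrix ι' ι' ℂ :=
  ∑ k, A k * ρ * (A k)ᴴ

/-- The adjoint of the map with Kraus operators `A`. -/
noncomputable def krausDual [Fintype ι'] (A : κ → Matrix ι' ι ℂ) (X : Matrix ι' ι' ℂ) :
    Matrix ι ι ℂ :=
  ∑ k, (A k)ᴴ * X * A k

theorem conjTranspose_krausDual [Fintype ι'] (A : κ → Matrix ι' ι ℂ) (X : Matrix ι' ι' ℂ) :
    (krausDual A X)ᴴ = krausDual A Xᴴ := by
  simp [krausDual, conjTranspose_sum, Matrix.mul_assoc]

variable [Fintype ι]

theorem krausMap_sub (A : κ → Matrix ι' ι ℂ) (ρ σ : Matrix ι ι ℂ) :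
    krausMap A (ρ - σ) = krausMap A ρ - krausMap A σ := by
  simp [krausMap, Matrix.mul_sub, Matrix.sub_mul]

theorem krausMap_smul (A : κ → Matrix ι' ι ℂ) (c : ℂ) (ρ : Matrix ι ι ℂ) :
    krausMap A (c • ρ) = c • krausMap A ρ := by
  simp [krausMap, Finset.smul_sum]

theorem krausMap_sum {α : Type*} [Fintype α] (A : κ → Matrix ι' ι ℂ) (ρ : α → Matrix ι ι ℂ) :
    krausMap A (∑ x, ρ x) = ∑ x, krausMap A (ρ x) := by
  simp only [krausMap, Matrix.mul_sum, Matrix.sum_mul]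
  exact Finset.sum_comm

variable [Fintype ι']

theorem Matrix.PosSemidef.krausMap {ρ : Matrix ι ι ℂ} (hρ : ρ.PosSemidef)
    (A : κ → Matrix ι' ι ℂ) : (krausMap A ρ).PosSemidef :=
  posSemidef_sum _ fun k _ => hρ.mul_mul_conjTranspose_same (A k)

theorem trace_krausDual_mul (A : κ → Matrix ι' ι ℂ) (X : Matrix ι' ι' ℂ) (ρ : Matrix ι ι ℂ) :
    (krausDual A X * ρ).trace = (X * krausMap A ρ).trace := by
  simp only [krausDual, krausMap, Finset.mul_sum, Finset.sum_mul, trace_sum]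
  refine Finset.sum_congr rfl fun k _ => ?_
  rw [Matrix.mul_assoc, Matrix.mul_assoc, trace_mul_comm]
  simp only [Matrix.mul_assoc]

variable [DecidableEq ι]

theorem trace_krausMap {A : κ → Matrix ι' ι ℂ} (hA : ∑ k, (A k)ᴴ * A k = 1) (ρ : Matrix ι ι ℂ) :
    (krausMap A ρ).trace = ρ.trace := by
  classical
  have h := trace_krausDual_mul A 1 ρ
  rw [one_mul] at h
  rw [← h, krausDual]
  simp [hA]

/-- The Kadison–Schwarz inequality, tested against a positive semidefinite matrix. -/
theorem re_trace_krausDual_sandwich_le {A : κ → Matrix ι' ι ℂ} (hA : ∑ k, (A k)ᴴ * A k = 1)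
    {ρ : Matrix ι ι ℂ} (hρ : ρ.PosSemidef) (X : Matrix ι' ι' ℂ) :
    (krausDual A Xᴴ * ρ * krausDual A X).trace.re ≤ (Xᴴ * krausMap A ρ * X).trace.re := by
  set Z := krausDual A X with hZ
  have hZs : krausDual A Xᴴ = Zᴴ := (conjTranspose_krausDual A X).symm
  have key : ∑ k, ((A k)ᴴ * X - Z * (A k)ᴴ) * ((A k)ᴴ * X - Z * (A k)ᴴ)ᴴ =
      krausDual A (X * Xᴴ) - Z * Zᴴ := by
    have h1 : ∑ k, (A k)ᴴ * X * A k * Zᴴ = Z * Zᴴ := by rw [← Finset.sum_mul]; rfl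
    have h2 : ∑ k, Z * ((A k)ᴴ * Xᴴ * A k) = Z * Zᴴ := by
      rw [← Finset.mul_sum, ← hZs]; rfl
    have h3 : ∑ k, Z * ((A k)ᴴ * A k) * Zᴴ = Z * Zᴴ := by
      rw [← Finset.sum_mul, ← Finset.mul_sum, hA, mul_one]
    have h4 : ∑ k, (A k)ᴴ * (X * Xᴴ) * A k = krausDual A (X * Xᴴ) := rfl
    have : ∀ k, ((A k)ᴴ * X - Z * (A k)ᴴ) * ((A k)ᴴ * X - Z * (A k)ᴴ)ᴴ =
        (A k)ᴴ * (X * Xᴴ) * A k - (A k)ᴴ * X * A k * Zᴴ - Z * ((A k)ᴴ * Xᴴ * A k)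
          + Z * ((A k)ᴴ * A k) * Zᴴ := fun k => by
      simp only [conjTranspose_sub, conjTranspose_mul, conjTranspose_conjTranspose,
        Matrix.mul_sub, Matrix.sub_mul, Matrix.mul_assoc]
      abel
    simp only [this, Finset.sum_add_distrib, Finset.sum_sub_distrib, h1, h2, h3, h4]
    abel
  have hnn : 0 ≤ ((krausDual A (X * Xᴴ) - Z * Zᴴ) * ρ).trace.re := by
    rw [← key, Finset.sum_mul, trace_sum, Complex.re_sum]
    refine Finset.sum_nonneg fun k _ => ?_
    rw [Matrix.mul_assoc, trace_mul_comm]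
    exact (Complex.le_def.1 (hρ.conjTranspose_mul_mul_same _).trace_nonneg).1
  rw [sub_mul, trace_sub, trace_krausDual_mul, Complex.sub_re, sub_nonneg] at hnn
  have e1 : (Z * Zᴴ * ρ).trace = (Zᴴ * ρ * Z).trace := by
    rw [mul_assoc, trace_mul_comm]
  have e2 : (X * Xᴴ * krausMap A ρ).trace = (Xᴴ * krausMap A ρ * X).trace := by
    rw [mul_assoc, trace_mul_comm]
  rw [hZs, ← e1, ← e2]
  exact hnn

theorem quasiForm_krausMap_le {A : κ → Matrix ι' ι ℂ} (hA : ∑ k, (A k)ᴴ * A k = 1) {s : ℝ}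
    (hs : s ∈ Set.Ioo (0 : ℝ) 1) {ρ σ : Matrix ι ι ℂ} (hρ : ρ.PosSemidef) (hσ : σ.PosSemidef)
    (X : Matrix ι' ι' ℂ) :
    quasiForm s (krausMap A ρ) (krausMap A σ) X ≤ quasiForm s ρ σ (krausDual A X) := by
  have h1 := re_trace_krausDual_sandwich_le hA hρ X
  have h2 := re_trace_krausDual_sandwich_le hA hσ Xᴴ
  rw [conjTranspose_conjTranspose] at h2
  rw [quasiForm, quasiForm, conjTranspose_krausDual, trace_krausDual_mul, krausMap_sub]
  have h3 := mul_le_mul_of_nonneg_left h1 (sub_nonneg.2 hs.2.le)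
  have h4 := mul_le_mul_of_nonneg_left h2 hs.1.le
  linarith

end Channel

section RelativeEntropy

variable {ι : Type*} [Fintype ι] [DecidableEq ι]

theorem sum_normSq_left {M : Matrix ι ι ℂ} (hM : Mᴴ * M = 1) (j : ι) :
    ∑ i, Complex.normSq (M i j) = 1 := by
  have h := congrFun (congrFun hM j) j
  rw [mul_apply, one_apply_eq] at h
  have h' : ((∑ i, Complex.normSq (M i j) : ℝ) : ℂ) = 1 := by
    rw [← h]
    push_cast
    exact Finset.sum_congr rfl fun i _ => by
      rw [Complex.normSq_eq_conj_mul_self, conjTranspose_apply, Complex.star_def]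
  exact_mod_cast h'

theorem sum_normSq_right {M : Matrix ι ι ℂ} (hM : Mᴴ * M = 1) (i : ι) :
    ∑ j, Complex.normSq (M i j) = 1 := by
  have h := sum_normSq_left (M := Mᴴ)
    (by rw [conjTranspose_conjTranspose]; exact mul_eq_one_comm.1 hM) i
  simpa using h

/-- The relative entropy in terms of eigenvalues `p`, `q` and the matrix `M` of overlaps of the
eigenvectors. -/
noncomputable def spectralRelEntropy (p q : ι → ℝ) (M : Matrix ι ι ℂ) : ℝ :=
  ∑ i, ∑ j, Complex.normSq (M i j) * (p i * Real.log (p i) - p i * Real.log (q j))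

theorem quasiPrimitive_one_sub_zero {p q : ι → ℝ} {M : Matrix ι ι ℂ} (hM : Mᴴ * M = 1) :
    quasiPrimitive p q M 1 - quasiPrimitive p q M 0 =
      spectralRelEntropy p q M + ∑ j, q j - ∑ i, p i := by
  have hq : ∑ j, q j = ∑ i, ∑ j, Complex.normSq (M i j) * q j := by
    rw [Finset.sum_comm]
    exact Finset.sum_congr rfl fun j _ => by rw [← Finset.sum_mul, sum_normSq_left hM, one_mul]
  have hp : ∑ i, p i = ∑ i, ∑ j, Complex.normSq (M i j) * p i :=
    Finset.sum_congr rfl fun i _ => by rw [← Finset.sum_mul, sum_normSq_right hM, one_mul]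
  rw [hp, hq, quasiPrimitive, quasiPrimitive, spectralRelEntropy]
  simp only [← Finset.sum_sub_distrib, ← Finset.sum_add_distrib]
  refine Finset.sum_congr rfl fun i _ => Finset.sum_congr rfl fun j _ => ?_
  simp only [sub_self, zero_mul, zero_add, one_mul, sub_zero, add_zero]
  ring

/-- The matrix of overlaps between the eigenvectors of `ρ` and `σ`. -/
noncomputable def eigenOverlap {ρ σ : Matrix ι ι ℂ} (hρ : ρ.IsHermitian) (hσ : σ.IsHermitian) :
    Matrix ι ι ℂ :=
  (hρ.eigenvectorUnitary : Matrix ι ι ℂ)ᴴ * (hσ.eigenvectorUnitary : Matrix ι ι ℂ)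

/-- The relative entropy (with natural logarithm) of Hermitian matrices. -/
noncomputable def relEntropy {ρ σ : Matrix ι ι ℂ} (hρ : ρ.IsHermitian) (hσ : σ.IsHermitian) : ℝ :=
  spectralRelEntropy hρ.eigenvalues hσ.eigenvalues (eigenOverlap hρ hσ)

theorem eigenvectorUnitary_conjTranspose_mul_self {ρ : Matrix ι ι ℂ} (hρ : ρ.IsHermitian) :
    (hρ.eigenvectorUnitary : Matrix ι ι ℂ)ᴴ * (hρ.eigenvectorUnitary : Matrix ι ι ℂ) = 1 :=
  Unitary.coe_star_mul_self hρ.eigenvectorUnitary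

theorem eigenOverlap_conjTranspose_mul_self {ρ σ : Matrix ι ι ℂ} (hρ : ρ.IsHermitian)
    (hσ : σ.IsHermitian) : (eigenOverlap hρ hσ)ᴴ * eigenOverlap hρ hσ = 1 := by
  have h := mul_eq_one_comm.1 (eigenvectorUnitary_conjTranspose_mul_self hρ)
  rw [eigenOverlap, conjTranspose_mul, conjTranspose_conjTranspose, mul_assoc,
    ← mul_assoc _ _ (hσ.eigenvectorUnitary : Matrix ι ι ℂ), h, one_mul,
    eigenvectorUnitary_conjTranspose_mul_self]

theorem eq_eigenvectorUnitary_mul_diagonal_mul {ρ : Matrix ι ι ℂ} (hρ : ρ.IsHermitian) :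
    ρ = (hρ.eigenvectorUnitary : Matrix ι ι ℂ) * diagonal (fun i => (hρ.eigenvalues i : ℂ)) *
      (hρ.eigenvectorUnitary : Matrix ι ι ℂ)ᴴ :=
  hρ.spectral_theorem

/-- The diagonal of `ρ` in an eigenbasis of `σ`. -/
theorem diag_conj_eigenvectorUnitary {ρ σ : Matrix ι ι ℂ} (hρ : ρ.IsHermitian)
    (hσ : σ.IsHermitian) (j : ι) :
    ((hσ.eigenvectorUnitary : Matrix ι ι ℂ)ᴴ * ρ * (hσ.eigenvectorUnitary : Matrix ι ι ℂ)) j j =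
      ((∑ i, Complex.normSq (eigenOverlap hρ hσ i j) * hρ.eigenvalues i : ℝ) : ℂ) := by
  have h : (hσ.eigenvectorUnitary : Matrix ι ι ℂ)ᴴ * ρ * (hσ.eigenvectorUnitary : Matrix ι ι ℂ) =
      (eigenOverlap hρ hσ)ᴴ *
        (diagonal (fun i => (hρ.eigenvalues i : ℂ)) * eigenOverlap hρ hσ) := by
    conv_lhs => rw [eq_eigenvectorUnitary_mul_diagonal_mul hρ]
    simp only [eigenOverlap, conjTranspose_mul, conjTranspose_conjTranspose, mul_assoc]
  rw [h, mul_apply]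
  push_cast
  refine Finset.sum_congr rfl fun i _ => ?_
  rw [Complex.normSq_eq_conj_mul_self, conjTranspose_apply, diagonal_mul, Complex.star_def]
  ring

theorem diag_conj_eigenvectorUnitary_self {σ : Matrix ι ι ℂ} (hσ : σ.IsHermitian) (j : ι) :
    ((hσ.eigenvectorUnitary : Matrix ι ι ℂ)ᴴ * σ * (hσ.eigenvectorUnitary : Matrix ι ι ℂ)) j j =
      (hσ.eigenvalues j : ℂ) := by
  rw [diag_conj_eigenvectorUnitary hσ hσ, eigenOverlap, eigenvectorUnitary_conjTranspose_mul_self,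
    Finset.sum_eq_single j]
  · simp
  · intro i _ hij
    simp [one_apply_ne hij]
  · simp

theorem normSq_eigenOverlap_mul_eq_zero {ρ σ : Matrix ι ι ℂ} (hρ : ρ.PosSemidef)
    (hσ : σ.PosSemidef) {δ : ℝ} (hδ : 0 < δ) (hd : (σ - (δ : ℂ) • ρ).PosSemidef) (i j : ι)
    (hj : hσ.1.eigenvalues j = 0) :
    Complex.normSq (eigenOverlap hρ.1 hσ.1 i j) * hρ.1.eigenvalues i = 0 := by
  have h := (hd.conjTranspose_mul_mul_same
    (hσ.1.eigenvectorUnitary : Matrix ι ι ℂ)).diag_nonneg (i := j)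
  rw [mul_sub, sub_mul, Matrix.sub_apply, Matrix.mul_smul, Matrix.smul_mul, Matrix.smul_apply,
    diag_conj_eigenvectorUnitary_self, diag_conj_eigenvectorUnitary hρ.1 hσ.1, hj, smul_eq_mul,
    ← Complex.ofReal_mul, ← Complex.ofReal_sub] at h
  have h' : 0 ≤ 0 - δ * ∑ i, Complex.normSq (eigenOverlap hρ.1 hσ.1 i j) * hρ.1.eigenvalues i := by
    exact_mod_cast h
  have hnn : ∀ i ∈ Finset.univ,
      0 ≤ Complex.normSq (eigenOverlap hρ.1 hσ.1 i j) * hρ.1.eigenvalues i :=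
    fun i _ => mul_nonneg (Complex.normSq_nonneg _) (hρ.eigenvalues_nonneg i)
  have h0 : ∑ i, Complex.normSq (eigenOverlap hρ.1 hσ.1 i j) * hρ.1.eigenvalues i = 0 :=
    le_antisymm (by nlinarith) (Finset.sum_nonneg hnn)
  exact (Finset.sum_eq_zero_iff_of_nonneg hnn).1 h0 i (Finset.mem_univ i)

theorem sum_eigenvalues_eq_re_trace {ρ : Matrix ι ι ℂ} (hρ : ρ.IsHermitian) :
    ∑ i, hρ.eigenvalues i = ρ.trace.re := by
  rw [hρ.trace_eq_sum_eigenvalues]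
  simp

/-- Monotonicity of the relative entropy under quantum channels. -/
theorem relEntropy_krausMap_le {ι' κ : Type*} [Fintype ι'] [DecidableEq ι'] [Fintype κ]
    {A : κ → Matrix ι' ι ℂ} (hA : ∑ k, (A k)ᴴ * A k = 1) {ρ σ : Matrix ι ι ℂ}
    (hρ : ρ.PosSemidef) (hσ : σ.PosSemidef) {δ : ℝ} (hδ : 0 < δ)
    (hd : (σ - (δ : ℂ) • ρ).PosSemidef) :
    relEntropy (hρ.krausMap A).1 (hσ.krausMap A).1 ≤ relEntropy hρ.1 hσ.1 := by
  have hd' : (krausMap A σ - (δ : ℂ) • krausMap A ρ).PosSemidef := by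
    rw [← krausMap_smul, ← krausMap_sub]
    exact hd.krausMap A
  have hin := normSq_eigenOverlap_mul_eq_zero hρ hσ hδ hd
  have hout := normSq_eigenOverlap_mul_eq_zero (hρ.krausMap A) (hσ.krausMap A) hδ hd'
  have hquasi : ∀ s ∈ Set.Ioo (0 : ℝ) 1,
      quasiEntropy s (hρ.krausMap A).1.eigenvalues (hσ.krausMap A).1.eigenvalues
        (eigenOverlap (hρ.krausMap A).1 (hσ.krausMap A).1) ≤
      quasiEntropy s hρ.1.eigenvalues hσ.1.eigenvalues (eigenOverlap hρ.1 hσ.1) := by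
    intro s hs
    obtain ⟨X, hX⟩ := exists_quasiForm_eq_quasiEntropy hs (hρ.krausMap A).eigenvalues_nonneg
      (hσ.krausMap A).eigenvalues_nonneg
      (eigenvectorUnitary_conjTranspose_mul_self (hρ.krausMap A).1)
      (eigenvectorUnitary_conjTranspose_mul_self (hσ.krausMap A).1)
    rw [← eq_eigenvectorUnitary_mul_diagonal_mul, ← eq_eigenvectorUnitary_mul_diagonal_mul] at hX
    have h := quasiForm_le_quasiEntropy hs hρ.eigenvalues_nonneg hσ.eigenvalues_nonneg
      (eigenvectorUnitary_conjTranspose_mul_self hρ.1)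
      (eigenvectorUnitary_conjTranspose_mul_self hσ.1) (krausDual A X)
    rw [← eq_eigenvectorUnitary_mul_diagonal_mul, ← eq_eigenvectorUnitary_mul_diagonal_mul] at h
    exact hX.symm.le.trans ((quasiForm_krausMap_le hA hs hρ hσ X).trans h)
  have hmono : MonotoneOn
      (quasiPrimitive hρ.1.eigenvalues hσ.1.eigenvalues (eigenOverlap hρ.1 hσ.1) -
        quasiPrimitive (hρ.krausMap A).1.eigenvalues (hσ.krausMap A).1.eigenvalues
          (eigenOverlap (hρ.krausMap A).1 (hσ.krausMap A).1)) (Set.Icc 0 1) := by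
    have hder := fun s (hs : s ∈ Set.Ioo (0 : ℝ) 1) =>
      (hasDerivAt_quasiPrimitive hρ.eigenvalues_nonneg hσ.eigenvalues_nonneg hin hs).sub
        (hasDerivAt_quasiPrimitive (hρ.krausMap A).eigenvalues_nonneg
          (hσ.krausMap A).eigenvalues_nonneg hout hs)
    refine monotoneOn_of_deriv_nonneg (convex_Icc 0 1)
      ((continuousOn_quasiPrimitive hρ.eigenvalues_nonneg hσ.eigenvalues_nonneg hin).sub
        (continuousOn_quasiPrimitive (hρ.krausMap A).eigenvalues_nonneg
          (hσ.krausMap A).eigenvalues_nonneg hout)) ?_ ?_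
    · rw [interior_Icc]
      exact fun s hs => (hder s hs).differentiableAt.differentiableWithinAt
    · rw [interior_Icc]
      intro s hs
      rw [(hder s hs).deriv, ← mul_sub]
      exact mul_nonneg hs.1.le (sub_nonneg.2 (hquasi s hs))
  have h01 := hmono (Set.left_mem_Icc.2 zero_le_one) (Set.right_mem_Icc.2 zero_le_one) zero_le_one
  have e1 := quasiPrimitive_one_sub_zero (p := hρ.1.eigenvalues) (q := hσ.1.eigenvalues)
    (eigenOverlap_conjTranspose_mul_self hρ.1 hσ.1)
  have e2 := quasiPrimitive_one_sub_zero (p := (hρ.krausMap A).1.eigenvalues)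
    (q := (hσ.krausMap A).1.eigenvalues)
    (eigenOverlap_conjTranspose_mul_self (hρ.krausMap A).1 (hσ.krausMap A).1)
  simp only [sum_eigenvalues_eq_re_trace, trace_krausMap hA] at e1 e2
  simp only [Pi.sub_apply] at h01
  rw [relEntropy, relEntropy]
  linarith

end RelativeEntropy

section Holevo

variable {ι : Type*} [Fintype ι] [DecidableEq ι]

theorem vnEntropy_mul_log_two {ρ : Matrix ι ι ℂ} (hρ : ρ.IsHermitian) :
    vnEntropy ρ * Real.log 2 = -∑ i, hρ.eigenvalues i * Real.log (hρ.eigenvalues i) := by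
  have h2 : Real.log 2 ≠ 0 := (Real.log_pos one_lt_two).ne'
  rw [vnEntropy, dif_pos hρ, Finset.sum_mul, ← Finset.sum_neg_distrib]
  refine Finset.sum_congr rfl fun i _ => ?_
  rw [negMulLogb, Real.logb]
  field_simp

theorem relEntropy_eq {ρ σ : Matrix ι ι ℂ} (hρ : ρ.IsHermitian) (hσ : σ.IsHermitian) :
    relEntropy hρ hσ = -(vnEntropy ρ * Real.log 2) - ∑ j, Real.log (hσ.eigenvalues j) *
      (((hσ.eigenvectorUnitary : Matrix ι ι ℂ)ᴴ * ρ *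
        (hσ.eigenvectorUnitary : Matrix ι ι ℂ)) j j).re := by
  rw [vnEntropy_mul_log_two hρ, neg_neg, relEntropy, spectralRelEntropy]
  simp only [mul_sub, Finset.sum_sub_distrib, ← Finset.sum_mul,
    sum_normSq_right (eigenOverlap_conjTranspose_mul_self hρ hσ), one_mul]
  congr 1
  rw [Finset.sum_comm]
  refine Finset.sum_congr rfl fun j _ => ?_
  rw [diag_conj_eigenvectorUnitary hρ hσ, Complex.ofReal_re, Finset.mul_sum]
  exact Finset.sum_congr rfl fun i _ => by ring

/-- The Holevo quantity is the mean relative entropy with respect to the average state. -/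
theorem sum_mul_relEntropy {𝒳 : Type*} [Fintype 𝒳] (P : 𝒳 → ℝ) {W : 𝒳 → Matrix ι ι ℂ}
    (hW : ∀ x, (W x).IsHermitian) {σ : Matrix ι ι ℂ} (hσ : σ.IsHermitian)
    (h : ∑ x, (P x : ℂ) • W x = σ) :
    ∑ x, P x * relEntropy (hW x) hσ =
      (vnEntropy σ - ∑ x, P x * vnEntropy (W x)) * Real.log 2 := by
  have hlog : ∑ x, P x * ∑ j, Real.log (hσ.eigenvalues j) *
      (((hσ.eigenvectorUnitary : Matrix ι ι ℂ)ᴴ * W x *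
        (hσ.eigenvectorUnitary : Matrix ι ι ℂ)) j j).re =
      ∑ j, hσ.eigenvalues j * Real.log (hσ.eigenvalues j) := by
    simp only [Finset.mul_sum]
    rw [Finset.sum_comm]
    refine Finset.sum_congr rfl fun j _ => ?_
    have hj := congrArg Complex.re (diag_conj_eigenvectorUnitary_self hσ j)
    nth_rw 2 [← h] at hj
    simp only [Finset.mul_sum, Finset.sum_mul, Matrix.sum_apply, Matrix.mul_smul, Matrix.smul_mul,
      Matrix.smul_apply, smul_eq_mul, Complex.re_sum, Complex.re_ofReal_mul,
      Complex.ofReal_re] at hj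
    refine Eq.trans ?_ (congrArg (· * Real.log (hσ.eigenvalues j)) hj)
    rw [Finset.sum_mul]
    exact Finset.sum_congr rfl fun x _ => by ring
  simp only [relEntropy_eq, mul_sub, Finset.sum_sub_distrib, hlog]
  rw [sub_mul, vnEntropy_mul_log_two hσ, Finset.sum_mul]
  simp only [mul_neg, Finset.sum_neg_distrib, mul_assoc]
  ring

end Holevo

/-- monotonicity of the Holevo quantity under a quantum channel `Φ`
given in Kraus form `Φ(ρ) = ∑ k, A k * ρ * (A k)ᴴ` with `∑ k, (A k)ᴴ * A k = 1`. -/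
theorem holevo_quantity_monotone {n m : ℕ} {𝒳 κ : Type} [Fintype 𝒳] [Fintype κ]
    (P : 𝒳 → ℝ) (hP : ∀ x, 0 ≤ P x) (hPsum : ∑ x, P x = 1)
    (W : 𝒳 → Matrix (Fin n) (Fin n) ℂ) (hW : ∀ x, MatState (W x))
    (A : κ → Matrix (Fin m) (Fin n) ℂ)
    (hA : ∑ k, (A k)ᴴ * A k = 1) :
    vnEntropy (∑ x, (P x : ℂ) • (∑ k, A k * W x * (A k)ᴴ)) -
        ∑ x, P x * vnEntropy (∑ k, A k * W x * (A k)ᴴ) ≤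
      vnEntropy (∑ x, (P x : ℂ) • W x) - ∑ x, P x * vnEntropy (W x) := by
  have hWpsd : ∀ x, ((P x : ℂ) • W x).PosSemidef := fun x =>
    (hW x).1.smul (Complex.zero_le_real.2 (hP x))
  have hσ : (∑ x, (P x : ℂ) • W x).PosSemidef := posSemidef_sum _ fun x _ => hWpsd x
  have hmap : ∑ x, (P x : ℂ) • krausMap A (W x) = krausMap A (∑ x, (P x : ℂ) • W x) := by
    simp only [krausMap_sum, krausMap_smul]
  have hle : ∀ x, P x * relEntropy ((hW x).1.krausMap A).1 (hσ.krausMap A).1 ≤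
      P x * relEntropy (hW x).1.1 hσ.1 := by
    intro x
    rcases (hP x).eq_or_lt with h0 | hpos
    · simp [← h0]
    · classical
      refine mul_le_mul_of_nonneg_left
        (relEntropy_krausMap_le hA (hW x).1 hσ hpos ?_) hpos.le
      rw [← Finset.add_sum_erase _ _ (Finset.mem_univ x), add_sub_cancel_left]
      exact posSemidef_sum _ fun y _ => hWpsd y
  have hsum := Finset.sum_le_sum fun x (_ : x ∈ Finset.univ) => hle x
  rw [sum_mul_relEntropy P (fun x => ((hW x).1.krausMap A).1) (hσ.krausMap A).1 hmap,
    sum_mul_relEntropy P (fun x => (hW x).1.1) hσ.1 rfl, ← hmap] at hsum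
  exact le_of_mul_le_mul_right hsum (Real.log_pos one_lt_two)
end

section
/- Triangle (Araki–Lieb) inequality for compatible subalgebras: Let 𝔛 and 𝔜 be compatible unital *-subalgebras of M_n(ℂ) and ρ any state on M_n(ℂ). Then |H_ρ(𝔛) − H_ρ(𝔜)| ≤ H_ρ(𝔛𝔜). -/
open scoped ComplexOrder Kronecker
open Matrix

theorem Matrix.PosSemidef.trace_mul_mul_star_nonneg {α : Type*} [Fintype α] {ρ : Matrix α α ℂ}
    (hρ : ρ.PosSemidef)
    (z : Matrix α α ℂ) : 0 ≤ (ρ * (z * star z)).trace := by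
  have := (hρ.conjTranspose_mul_mul_same z).trace_nonneg
  rwa [mul_assoc, Matrix.trace_mul_comm, mul_assoc] at this

section

variable {α : Type*} [Fintype α] [DecidableEq α]

/-- Every function of a Hermitian element of a *-subalgebra lies in the subalgebra. -/
theorem StarSubalgebra.conj_diagonal_eigenvalues_mem (X : StarSubalgebra ℂ (Matrix α α ℂ))
    {h : Matrix α α ℂ}
    (hX : h ∈ X) (hh : h.IsHermitian) (f : ℝ → ℂ) :
    (hh.eigenvectorUnitary : Matrix α α ℂ) * diagonal (fun i => f (hh.eigenvalues i)) *
      star (hh.eigenvectorUnitary : Matrix α α ℂ) ∈ X := by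
  set s : Finset ℝ := Finset.univ.image hh.eigenvalues
  set P : Polynomial ℂ := Lagrange.interpolate s (fun t : ℝ => (t : ℂ)) f
  have hP (i : α) : P.eval (hh.eigenvalues i : ℂ) = f (hh.eigenvalues i) :=
    Lagrange.eval_interpolate_at_node f (Complex.ofReal_injective.injOn)
      (Finset.mem_image_of_mem _ (Finset.mem_univ i))
  have hmem : Polynomial.aeval h P ∈ X := 
    Algebra.adjoin_le (S := X.toSubalgebra) (by simpa using hX)
      (Polynomial.aeval_mem_adjoin_singleton ℂ h)
  have hdiag : diagonal (fun i => f (hh.eigenvalues i)) =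
      Polynomial.aeval (diagonal (fun i => (hh.eigenvalues i : ℂ))) P := by
    have := Polynomial.aeval_algHom_apply (diagonalAlgHom (n := α) (α := ℂ) ℂ)
      (fun i => (hh.eigenvalues i : ℂ)) P
    simp only [diagonalAlgHom_apply] at this
    rw [this, Polynomial.aeval_pi_apply]
    simp [Polynomial.coe_aeval_eq_eval, hP]
  have hspec := hh.spectral_theorem
  have : Polynomial.aeval h P = (hh.eigenvectorUnitary : Matrix α α ℂ) *
      diagonal (fun i => f (hh.eigenvalues i)) * star (hh.eigenvectorUnitary : Matrix α α ℂ) := by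
    conv_lhs => rw [hspec]
    rw [Polynomial.aeval_algHom_apply, Unitary.conjStarAlgAut_apply, hdiag]
    rfl
  rwa [← this]

theorem Matrix.IsHermitian.eq_conj_diagonal_s8 {h : Matrix α α ℂ} (hh : h.IsHermitian) :
    h = (hh.eigenvectorUnitary : Matrix α α ℂ) * diagonal (fun i => (hh.eigenvalues i : ℂ)) *
      star (hh.eigenvectorUnitary : Matrix α α ℂ) := by
  conv_lhs => rw [hh.spectral_theorem, Unitary.conjStarAlgAut_apply]
  rfl

theorem matLogb_mul_of_mul_eq_smul {r g : Matrix α α ℂ} (hr : r.IsHermitian) {ν : ℝ}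
    (h : r * g = (ν : ℂ) • g) : matLogb r * g = (Real.logb 2 ν : ℂ) • g := by
  set U : Matrix α α ℂ := (hr.eigenvectorUnitary : Matrix α α ℂ)
  have hU : star U * U = 1 := Unitary.coe_star_mul_self _
  have hU' : U * star U = 1 := Unitary.coe_mul_star_self _
  have hD : diagonal (fun i => (hr.eigenvalues i : ℂ)) * (star U * g) =
      (ν : ℂ) • (star U * g) := by
    have h2 := congrArg (star U * ·) h
    rw [hr.eq_conj_diagonal_s8] at h2
    change star U * (U * _ * star U * g) = star U * (_ • g) at h2
    rw [mul_assoc, mul_assoc, ← mul_assoc (star U), hU, one_mul, Matrix.mul_smul] at h2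
    exact h2
  have hL : diagonal (fun i => (Real.logb 2 (hr.eigenvalues i) : ℂ)) * (star U * g) =
      (Real.logb 2 ν : ℂ) • (star U * g) := by
    ext a b
    have := congrFun (congrFun hD a) b
    rw [diagonal_mul, Matrix.smul_apply, smul_eq_mul] at this ⊢
    rcases mul_eq_mul_right_iff.1 this with h3 | h3
    · rw [Complex.ofReal_injective h3]
    · rw [h3, mul_zero, mul_zero]
  rw [matLogb, dif_pos hr]
  change U * _ * star U * g = _
  rw [mul_assoc, mul_assoc, hL, Matrix.mul_smul, ← mul_assoc, hU', one_mul]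

theorem IsProjn.star_eq {p : Matrix α α ℂ} (hp : IsProjn p) : star p = p := hp.1

theorem IsProjn.mul_eq_of_mul_eq {p q : Matrix α α ℂ} (hp : IsProjn p) (hq : IsProjn q)
    (h : q * p = q) : p * q = q := by
  simpa [hp.star_eq, hq.star_eq] using congrArg star h

theorem IsProjn.sub {p q : Matrix α α ℂ} (hp : IsProjn p) (hq : IsProjn q) (h : q * p = q) :
    IsProjn (p - q) := by
  have h' := hp.mul_eq_of_mul_eq hq h
  refine ⟨hp.1.sub hq.1, ?_⟩
  simp [mul_sub, sub_mul, hp.2, hq.2, h, h']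

/-- A Hermitian element of a corner is a multiple of the unit of the corner, or has a spectral
projection which is a proper subprojection of that unit. -/
theorem exists_eq_smul_or_exists_projn (X : StarSubalgebra ℂ (Matrix α α ℂ)) {h p : Matrix α α ℂ}
    (hX : h ∈ X) (hh : h.IsHermitian) (hp : IsProjn p) (hhp : h * p = h) :
    (∃ μ : ℝ, h = (μ : ℂ) • p) ∨
      ∃ (μ : ℝ) (q : Matrix α α ℂ), q ∈ X ∧ IsProjn q ∧ q * p = q ∧ q ≠ 0 ∧ q ≠ p ∧
        h * q = (μ : ℂ) • q := by
  by_cases h0 : h = 0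
  · exact .inl ⟨0, by simp [h0]⟩
  obtain ⟨i, hi⟩ : ∃ i, hh.eigenvalues i ≠ 0 := by
    by_contra! hc
    exact h0 (hh.eigenvalues_eq_zero_iff.1 (funext hc))
  set μ := hh.eigenvalues i
  set U : Matrix α α ℂ := (hh.eigenvectorUnitary : Matrix α α ℂ)
  have hU : star U * U = 1 := Unitary.coe_star_mul_self _
  set d : α → ℂ := fun j => if hh.eigenvalues j = μ then 1 else 0 with hd
  set q : Matrix α α ℂ := U * diagonal d * star U with hq
  have hqX : q ∈ X := X.conj_diagonal_eigenvalues_mem hX hh (fun t => if t = μ then 1 else 0)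
  have conj_mul (a b : α → ℂ) : (U * diagonal a * star U) * (U * diagonal b * star U) =
      U * diagonal (a * b) * star U := by
    calc _ = U * diagonal a * (star U * U) * diagonal b * star U := by simp only [mul_assoc]
      _ = _ := by rw [hU, mul_one, mul_assoc U, diagonal_mul_diagonal]; rfl
  have hqp : IsProjn q := by
    constructor
    · change star q = q
      have : star (diagonal d) = diagonal d := by
        rw [star_eq_conjTranspose, diagonal_conjTranspose]
        congr 1; ext j; simp [hd, apply_ite]
      rw [hq, star_mul, star_mul, star_star, this, mul_assoc]
    · rw [hq, conj_mul]
      congr 3; ext j; simp [hd]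
  have hhq : h * q = (μ : ℂ) • q := by
    conv_lhs => rw [hh.eq_conj_diagonal_s8]
    change (U * _ * star U) * (U * diagonal d * star U) = _
    rw [conj_mul, hq, ← Matrix.smul_mul, ← Matrix.mul_smul, ← diagonal_smul]
    congr 3; ext j
    by_cases hj : hh.eigenvalues j = μ <;> simp [hd, hj]
  have hq0 : q ≠ 0 := by
    intro hq0
    have h1 : star U * q * U = diagonal d := by
      calc _ = (star U * U) * diagonal d * (star U * U) := by simp only [hq, mul_assoc]
        _ = _ := by rw [hU, mul_one, one_mul]
    rw [hq0, mul_zero, zero_mul] at h1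
    have := congrFun (congrFun h1 i) i
    simp [hd, μ] at this
  have hph : p * h = h := by
    simpa [hp.star_eq, hh.eq, star_eq_conjTranspose, hp.1.eq] using congrArg star hhp
  have hμ : (μ : ℂ) ≠ 0 := by exact_mod_cast hi
  have hpq : p * q = q := by
    have : (μ : ℂ) • q = (μ : ℂ) • (p * q) := by
      rw [← Matrix.mul_smul p, ← hhq, ← mul_assoc p h q, hph]
    exact (smul_right_injective _ hμ this).symm
  by_cases hqep : q = p
  · exact .inl ⟨μ, by rw [← hqep, ← hhq, hqep, hhp]⟩
  · refine .inr ⟨μ, q, hqX, hqp, ?_, hq0, hqep, hhq⟩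
    simpa [hp.star_eq, hqp.star_eq] using congrArg star hpq

theorem IsMinProjOf.corner {X : StarSubalgebra ℂ (Matrix α α ℂ)} {p : Matrix α α ℂ}
    (hp : IsMinProjOf X p)
    {a : Matrix α α ℂ} (ha : a ∈ X) : ∃ c : ℂ, p * a * p = c • p := by
  have herm (b : Matrix α α ℂ) (hb : b ∈ X) (hbh : b.IsHermitian) : ∃ c : ℂ, p * b * p = c • p := by
    have hh : (p * b * p).IsHermitian := by
      change star (p * b * p) = _
      rw [star_mul, star_mul, hp.2.1.star_eq, show star b = b from hbh, mul_assoc]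
    rcases exists_eq_smul_or_exists_projn X (mul_mem (mul_mem hp.1 hb) hp.1) hh hp.2.1
      (by rw [mul_assoc, hp.2.1.2]) with ⟨μ, h⟩ | ⟨μ, q, hqX, hq, hqp, hq0, hqne, -⟩
    · exact ⟨μ, h⟩
    · exact ((hp.2.2.2 q hqX hq hqp).elim hq0 hqne).elim
  obtain ⟨c, hc⟩ := herm (a + star a) (add_mem ha (star_mem ha)) (by
    change star _ = _; rw [star_add, star_star, add_comm])
  obtain ⟨d, hd⟩ := herm (Complex.I • (a - star a)) (X.smul_mem (sub_mem ha (star_mem ha)) _) (by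
    change star _ = _; rw [star_smul, star_sub, star_star, ← neg_sub, smul_neg]
    simp)
  refine ⟨(1 / 2) * (c - Complex.I * d), ?_⟩
  have : a = (1 / 2 : ℂ) • ((a + star a) - Complex.I • (Complex.I • (a - star a))) := by
    rw [smul_smul, Complex.I_mul_I]
    module
  rw [this, Matrix.mul_smul, Matrix.smul_mul, mul_sub, sub_mul, hc, Matrix.mul_smul,
    Matrix.smul_mul, hd]
  module

theorem IsMinProjOf.corner_eq {X : StarSubalgebra ℂ (Matrix α α ℂ)} {p : Matrix α α ℂ}
    (hp : IsMinProjOf X p)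
    {τ : Matrix α α ℂ →ₗ[ℂ] ℂ} (hτ : IsCanonicalTrace X τ) {a : Matrix α α ℂ} (ha : a ∈ X) :
    p * a * p = τ (a * p) • p := by
  obtain ⟨c, hc⟩ := hp.corner ha
  have h1 := congrArg τ hc
  rw [map_smul, hτ.2.2 p hp, smul_eq_mul, mul_one, hτ.1 _ (mul_mem hp.1 ha) _ hp.1, ← mul_assoc,
    hp.2.1.2, hτ.1 _ hp.1 _ ha] at h1
  rw [hc, h1]

theorem IsProjn.finrank_range_lt {p q : Matrix α α ℂ} (hp : IsProjn p) (hq : IsProjn q)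
    (hqp : q * p = q) (hne : q ≠ p) :
    Module.finrank ℂ (LinearMap.range (toLin' q)) <
      Module.finrank ℂ (LinearMap.range (toLin' p)) := by
  apply Submodule.finrank_lt_finrank_of_lt
  refine lt_of_le_of_ne ?_ fun h => hne ?_
  · rintro _ ⟨v, rfl⟩
    exact ⟨toLin' q v, by rw [← toLin'_mul_apply, hp.mul_eq_of_mul_eq hq hqp]⟩
  · rw [← hqp]
    apply toLin'.injective
    ext1 v
    ext1
    obtain ⟨w, hw⟩ : toLin' p (Pi.single v 1) ∈ LinearMap.range (toLin' q) :=
      h ▸ LinearMap.mem_range_self _ _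
    simp only [LinearMap.comp_apply, LinearMap.single_apply, toLin'_mul_apply]
    rw [← hw, ← toLin'_mul_apply, hq.2]

/-- A projection of a *-subalgebra commuting with a Hermitian element `r` of the subalgebra is
an orthogonal sum of minimal projections consisting of eigenvectors of `r`. -/
theorem exists_minProj_decomposition (X : StarSubalgebra ℂ (Matrix α α ℂ)) {r : Matrix α α ℂ}
    (hX : r ∈ X) (hr : r.IsHermitian) (p : Matrix α α ℂ) (hpX : p ∈ X) (hp : IsProjn p)
    (hrp : r * p = p * r) :
    ∃ (ι : Type) (_ : Fintype ι) (g : ι → Matrix α α ℂ) (ν : ι → ℝ),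
      (∀ i, IsMinProjOf X (g i)) ∧ (∀ i, r * g i = (ν i : ℂ) • g i) ∧
      (∑ i, g i = p) ∧ ∀ i j, i ≠ j → g i * g j = 0 := by
  induction hN : Module.finrank ℂ (LinearMap.range (toLin' p)) using Nat.strong_induction_on
    generalizing p with
  | _ N ih =>
  by_cases hp0 : p = 0
  · exact ⟨Empty, inferInstance, Empty.elim, Empty.elim, by simp, by simp, by simp [hp0], by simp⟩
  have split (q : Matrix α α ℂ) (hqX : q ∈ X) (hq : IsProjn q) (hqp : q * p = q) (hq0 : q ≠ 0)
      (hqne : q ≠ p) (hrq : r * q = q * r) :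
      ∃ (ι : Type) (_ : Fintype ι) (g : ι → Matrix α α ℂ) (ν : ι → ℝ),
        (∀ i, IsMinProjOf X (g i)) ∧ (∀ i, r * g i = (ν i : ℂ) • g i) ∧
        (∑ i, g i = p) ∧ ∀ i j, i ≠ j → g i * g j = 0 := by
    have hpq := hp.mul_eq_of_mul_eq hq hqp
    obtain ⟨ι, _, g, ν, hg, hν, hsum, horth⟩ :=
      ih _ (hN ▸ hp.finrank_range_lt hq hqp hqne) q hqX hq hrq rfl
    obtain ⟨κ, _, g', ν', hg', hν', hsum', horth'⟩ :=
      ih _ (hN ▸ hp.finrank_range_lt (hp.sub hq hqp) (by rw [sub_mul, hp.2, hqp])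
        (by simpa using hq0)) (p - q) (sub_mem hpX hqX) (hp.sub hq hqp)
        (by rw [mul_sub, sub_mul, hrp, hrq]) rfl
    have h1 (i : ι) : g i * q = g i := by
      rw [← hsum, Finset.mul_sum, Finset.sum_eq_single i (fun j _ hj => horth i j hj.symm)
        (by simp), (hg i).2.1.2]
    have h2 (i : κ) : g' i * (p - q) = g' i := by
      rw [← hsum', Finset.mul_sum, Finset.sum_eq_single i (fun j _ hj => horth' i j hj.symm)
        (by simp), (hg' i).2.1.2]
    have h1' (i : ι) : q * g i = g i := hq.mul_eq_of_mul_eq (hg i).2.1 (h1 i)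
    have h2' (i : κ) : (p - q) * g' i = g' i :=
      (hp.sub hq hqp).mul_eq_of_mul_eq (hg' i).2.1 (h2 i)
    have h12 (i : ι) (j : κ) : g i * g' j = 0 := by
      rw [← h1, ← h2', mul_assoc, ← mul_assoc q, mul_sub, hqp, hq.2, sub_self, zero_mul, mul_zero]
    have h21 (i : ι) (j : κ) : g' j * g i = 0 := by
      rw [← h1', ← h2, mul_assoc, ← mul_assoc (p - q), sub_mul, hpq, hq.2, sub_self, zero_mul,
        mul_zero]
    refine ⟨ι ⊕ κ, inferInstance, Sum.elim g g', Sum.elim ν ν', ?_, ?_, ?_, ?_⟩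
    · rintro (i | i)
      exacts [hg i, hg' i]
    · rintro (i | i)
      exacts [hν i, hν' i]
    · simp [hsum, hsum']
    · rintro (i | i) (j | j) hij
      exacts [horth i j (by simpa using hij), h12 i j, h21 j i, horth' i j (by simpa using hij)]
  have hh : (r * p).IsHermitian := by
    change star (r * p) = _
    rw [star_mul, hp.star_eq, show star r = r from hr, hrp]
  rcases exists_eq_smul_or_exists_projn X (mul_mem hX hpX) hh hp
    (by rw [mul_assoc, hp.2]) with ⟨μ, hμ⟩ | ⟨μ, q, hqX, hq, hqp, hq0, hqne, hμ⟩
  · by_cases hmin : IsMinProjOf X p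
    · exact ⟨Unit, inferInstance, fun _ => p, fun _ => μ, fun _ => hmin, fun _ => hμ, by simp,
        fun i j hij => (hij rfl).elim⟩
    · simp only [IsMinProjOf, not_and, not_forall, not_or] at hmin
      obtain ⟨q, hqX, hq, hqp, hq0, hqne⟩ := hmin hpX hp hp0
      refine split q hqX hq hqp hq0 hqne ?_
      have h1 : r * q = (μ : ℂ) • q := by
        rw [← hp.mul_eq_of_mul_eq hq hqp, ← mul_assoc, hμ, Matrix.smul_mul]
      have h2 : q * r = (μ : ℂ) • q := by
        rw [← hqp, mul_assoc, ← hrp, hμ, Matrix.mul_smul]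
      rw [h1, h2]
  · refine split q hqX hq hqp hq0 hqne ?_
    have h1 : r * q = (μ : ℂ) • q := by
      rw [← hμ, mul_assoc, hp.mul_eq_of_mul_eq hq hqp]
    have h2 := congrArg star h1
    rw [star_mul, star_smul, hq.star_eq, show star r = r from hr] at h2
    rw [h1, h2]
    simp

theorem StarSubalgebra.mem_mul_of_mem_sup {X Y : StarSubalgebra ℂ (Matrix α α ℂ)}
    (hXY : CompatibleAlg X Y) {w : Matrix α α ℂ} (hw : w ∈ X ⊔ Y) :
    w ∈ X.toSubalgebra.toSubmodule * Y.toSubalgebra.toSubmodule := by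
  set S := X.toSubalgebra.toSubmodule * Y.toSubalgebra.toSubmodule with hS
  have hmk {x y : Matrix α α ℂ} (hx : x ∈ X) (hy : y ∈ Y) : x * y ∈ S :=
    Submodule.mul_mem_mul (M := X.toSubalgebra.toSubmodule) (N := Y.toSubalgebra.toSubmodule) hx hy
  let W : StarSubalgebra ℂ (Matrix α α ℂ) :=
    { S with
      mul_mem' := by
        intro a b ha hb
        refine Submodule.mul_induction_on ha (fun x hx y hy => ?_) (fun u v hu hv => ?_)
        · refine Submodule.mul_induction_on hb (fun x' hx' y' hy' => ?_) (fun u v hu hv => ?_)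
          · have : x * y * (x' * y') = (x * x') * (y * y') := by
              rw [mul_assoc, ← mul_assoc y, ← hXY x' hx' y hy]
              simp only [mul_assoc]
            rw [this]
            exact hmk (mul_mem hx hx') (mul_mem hy hy')
          · rw [mul_add]
            exact S.add_mem hu hv
        · rw [add_mul]
          exact S.add_mem hu hv
      algebraMap_mem' := fun c => by
        rw [← mul_one (algebraMap _ _ c)]
        exact hmk (X.algebraMap_mem c) (one_mem Y)
      star_mem' := by
        intro a ha
        refine Submodule.mul_induction_on ha (fun x hx y hy => ?_) (fun u v hu hv => ?_)
        · rw [star_mul, ← hXY _ (star_mem hx) _ (star_mem hy)]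
          exact hmk (star_mem hx) (star_mem hy)
        · rw [star_add]
          exact S.add_mem hu hv }
  have hXW : X ≤ W := fun x hx => show x ∈ S by simpa using hmk hx (one_mem Y)
  have hYW : Y ≤ W := fun y hy => show y ∈ S by simpa using hmk (one_mem X) hy
  exact sup_le hXW hYW hw

/-- Compressing by a minimal projection `f` of one of two compatible subalgebras maps the algebra
they generate into the other one, cut down by `f`. -/
theorem IsMinProjOf.exists_compress_eq {X Y : StarSubalgebra ℂ (Matrix α α ℂ)}
    (hXY : CompatibleAlg X Y) {f w : Matrix α α ℂ} (hf : IsMinProjOf Y f) (hw : w ∈ X ⊔ Y) :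
    ∃ x ∈ X, f * w * f = x * f := by
  refine Submodule.mul_induction_on (StarSubalgebra.mem_mul_of_mem_sup hXY hw)
    (fun x hx y hy => ?_) (fun u v hu hv => ?_)
  · obtain ⟨c, hc⟩ := hf.corner hy
    refine ⟨c • x, X.smul_mem hx c, ?_⟩
    rw [← mul_assoc, ← hXY x hx f hf.1, mul_assoc x, mul_assoc x, hc, Matrix.mul_smul,
      Matrix.smul_mul]
  · obtain ⟨x, hx, hx'⟩ := hu
    obtain ⟨y, hy, hy'⟩ := hv
    exact ⟨x + y, add_mem hx hy, by rw [mul_add, add_mul, hx', hy', add_mul]⟩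

theorem IsMinProjOf.mul {X Y : StarSubalgebra ℂ (Matrix α α ℂ)} (hXY : CompatibleAlg X Y)
    {g f : Matrix α α ℂ} (hg : IsMinProjOf X g) (hf : IsMinProjOf Y f) (h0 : g * f ≠ 0) :
    IsMinProjOf (X ⊔ Y) (g * f) := by
  have hgf := hXY g hg.1 f hf.1
  have hproj : IsProjn (g * f) := by
    constructor
    · change star (g * f) = _
      rw [star_mul, hg.2.1.star_eq, hf.2.1.star_eq, hgf]
    · rw [mul_assoc, ← mul_assoc f, ← hgf, mul_assoc g f f, hf.2.1.2, ← mul_assoc, hg.2.1.2]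
  refine ⟨mul_mem ((le_sup_left : X ≤ X ⊔ Y) hg.1) ((le_sup_right : Y ≤ X ⊔ Y) hf.1), hproj, h0,
    fun q hqX hq hqp => ?_⟩
  obtain ⟨x, hx, hqx⟩ := hf.exists_compress_eq hXY hqX
  obtain ⟨c, hc⟩ := hg.corner hx
  have hq' : q = c • (g * f) := by
    calc q = (g * f) * q * (g * f) := by
          rw [hproj.mul_eq_of_mul_eq hq hqp, hqp]
      _ = g * (f * q * f) * g := by rw [hgf]; nth_rw 1 [← hgf]; simp only [mul_assoc]
      _ = g * x * g * f := by rw [hqx, mul_assoc, mul_assoc x, ← hgf]; simp only [mul_assoc]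
      _ = _ := by rw [hc, Matrix.smul_mul]
  have hcc : c * c = c := by
    have := hq.2
    rw [hq', Matrix.smul_mul, Matrix.mul_smul, hproj.2, smul_smul] at this
    exact smul_left_injective _ h0 this
  rcases IsIdempotentElem.iff_eq_zero_or_one.1 hcc with h | h
  · exact .inl (by rw [hq', h, zero_smul])
  · exact .inr (by rw [hq', h, one_smul])

theorem IsCanonicalTrace.mul_star_nonneg {X : StarSubalgebra ℂ (Matrix α α ℂ)}
    {τ : Matrix α α ℂ →ₗ[ℂ] ℂ} (hτ : IsCanonicalTrace X τ) {z : Matrix α α ℂ} (hz : z ∈ X) :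
    0 ≤ τ (z * star z) := by
  simpa using hτ.2.1 (star z) (star_mem hz)

theorem IsCanonicalTrace.minProj_mul_mul_nonneg {X Y : StarSubalgebra ℂ (Matrix α α ℂ)}
    (hXY : CompatibleAlg X Y) {τ : Matrix α α ℂ →ₗ[ℂ] ℂ} (hτ : IsCanonicalTrace (X ⊔ Y) τ)
    {e f g : Matrix α α ℂ} (he : IsMinProjOf (X ⊔ Y) e) (hf : IsMinProjOf Y f)
    (hg : IsMinProjOf X g) : 0 ≤ τ (e * f * g) := by
  have hgf := hXY g hg.1 f hf.1
  have hgX : g ∈ X ⊔ Y := (le_sup_left : X ≤ X ⊔ Y) hg.1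
  have hfX : f ∈ X ⊔ Y := (le_sup_right : Y ≤ X ⊔ Y) hf.1
  have h := hτ.mul_star_nonneg (mul_mem (mul_mem he.1 hfX) hgX)
  have h1 : (e * f * g) * star (e * f * g) = (e * f * g) * e := by
    rw [star_mul, star_mul, he.2.1.star_eq, hf.2.1.star_eq, hg.2.1.star_eq]
    calc _ = e * (f * (g * g) * f) * e := by simp only [mul_assoc]
      _ = e * (f * f * g) * e := by rw [hg.2.1.2, mul_assoc f g f, hgf]; simp only [mul_assoc]
      _ = _ := by rw [hf.2.1.2]; simp only [mul_assoc]
  rwa [h1, hτ.1 _ (mul_mem (mul_mem he.1 hfX) hgX) _ he.1, ← mul_assoc, ← mul_assoc,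
    he.2.1.2] at h

/-- The spectral weight `l` of a minimal projection `e` of `X ⊔ Y` obeys
`l * τ (e f x⁻¹) ≤ 1`, where `x⁻¹` is the pseudo-inverse of the restriction to `X` and `f` is a
minimal projection of `Y`. -/
theorem IsRestriction.mul_sum_div_le_one {X Y : StarSubalgebra ℂ (Matrix α α ℂ)}
    (hXY : CompatibleAlg X Y) {ρ x r : Matrix α α ℂ} (hρ : ρ.PosSemidef)
    {τ T : Matrix α α ℂ →ₗ[ℂ] ℂ} (hτ : IsCanonicalTrace X τ) (hx : IsRestriction X τ ρ x)
    (hT : IsCanonicalTrace (X ⊔ Y) T) (hr : IsRestriction (X ⊔ Y) T ρ r)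
    {ι : Type*} [Fintype ι] {g : ι → Matrix α α ℂ} {ν : ι → ℝ} (hg : ∀ i, IsMinProjOf X (g i))
    (hν : ∀ i, x * g i = (ν i : ℂ) • g i) (horth : ∀ i j, i ≠ j → g i * g j = 0)
    {e f : Matrix α α ℂ} (he : IsMinProjOf (X ⊔ Y) e) (hf : IsMinProjOf Y f) {l : ℝ} (hl0 : 0 ≤ l)
    (hl : ∀ z ∈ X ⊔ Y, l * (T (e * (z * star z))).re ≤ (T (r * (z * star z))).re)
    {δ : ι → ℝ} (hδ : ∀ i, T (e * f * g i) = δ i) :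
    l * ∑ i, δ i / ν i ≤ 1 := by
  classical
  have hgX (i) : g i ∈ X ⊔ Y := (le_sup_left : X ≤ X ⊔ Y) (hg i).1
  have hfX : f ∈ X ⊔ Y := (le_sup_right : Y ≤ X ⊔ Y) hf.1
  have hgf (i) : g i * f = f * g i := hXY _ (hg i).1 f hf.1
  have hff := hf.2.1.2
  obtain ⟨c, hcX, hc⟩ := hf.exists_compress_eq hXY he.1
  obtain ⟨t₀, ht₀0, ht₀⟩ : ∃ t₀ : ℝ, 0 ≤ t₀ ∧ e * f * e = (t₀ : ℂ) • e := by
    have h1 := he.corner_eq hT hfX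
    have h2 := hT.2.1 (f * e) (mul_mem hfX he.1)
    have h3 : star (f * e) * (f * e) = e * f * e := by
      rw [star_mul, he.2.1.star_eq, hf.2.1.star_eq, mul_assoc, ← mul_assoc f, hff, ← mul_assoc]
    rw [h3, h1, map_smul, hT.2.2 e he, smul_eq_mul, mul_one, Complex.nonneg_iff] at h2
    refine ⟨(T (f * e)).re, h2.1, ?_⟩
    rw [h1]
    congr 1
    exact Complex.ext (by simp) (by simp [← h2.2])
  have hcc : c * star c * f = (t₀ : ℂ) • (f * e * f) := by
    have h1 : star (f * e * f) = f * e * f := by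
      rw [star_mul, star_mul, he.2.1.star_eq, hf.2.1.star_eq, mul_assoc]
    calc c * star c * f = (c * f) * star (c * f) := by
          rw [star_mul, hf.2.1.star_eq, mul_assoc c f, ← mul_assoc f f, hff, mul_assoc,
            hXY _ (star_mem hcX) f hf.1]
      _ = (f * e * f) * (f * e * f) := by rw [← hc, h1]
      _ = f * (e * (f * f) * e) * f := by simp only [mul_assoc]
      _ = _ := by rw [hff, ht₀]; simp only [Matrix.mul_smul, Matrix.smul_mul]
  set β : ι → ℝ := fun i => if g i * f = 0 then 0 else (ν i)⁻¹ with hβ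
  set a : Matrix α α ℂ := ∑ i, (β i : ℂ) • g i with ha
  have haX : a ∈ X := sum_mem fun i _ => X.smul_mem (hg i).1 _
  have haX' : a ∈ X ⊔ Y := (le_sup_left : X ≤ X ⊔ Y) haX
  have haf : a * f = f * a := hXY _ haX f hf.1
  have hastar : star a = a := by
    simp only [ha, star_sum, star_smul, (hg _).2.1.star_eq]
    simp
  set t : ℝ := ∑ i, β i * δ i with ht
  have hβδ : ∑ i, δ i / ν i = t := by
    refine Finset.sum_congr rfl fun i _ => ?_
    by_cases h0 : g i * f = 0
    · have := hδ i
      rw [mul_assoc, ← hgf, h0, mul_zero, map_zero] at this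
      simp [Complex.ofReal_eq_zero.1 this.symm]
    · simp only [hβ, if_neg h0]
      ring
  have hTa : T (e * f * a) = t := by
    simp [ha, Finset.mul_sum, ht, hδ]
  have haga (i) : a * g i = (β i : ℂ) • g i := by
    rw [ha, Finset.sum_mul, Finset.sum_eq_single i (fun j _ hj => by
      rw [Matrix.smul_mul, horth j i hj, smul_zero]) (by simp), Matrix.smul_mul, (hg i).2.1.2]
  have haxa : a * (x * a) = a := by
    conv_lhs => rw [ha]
    conv_rhs => rw [ha]
    rw [← ha, Finset.mul_sum, Finset.mul_sum]
    refine Finset.sum_congr rfl fun i _ => ?_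
    rw [Matrix.mul_smul, hν, Matrix.mul_smul, Matrix.mul_smul, haga, smul_smul, smul_smul]
    congr 1
    norm_cast
    by_cases h0 : g i * f = 0
    · simp [hβ, h0]
    · by_cases h1 : ν i = 0 <;> simp [hβ, h0, h1]
  set u := a * c with hu
  have huX : u ∈ X := mul_mem haX hcX
  have huX' : u ∈ X ⊔ Y := (le_sup_left : X ≤ X ⊔ Y) huX
  have huu : u * star u = a * (c * star c) * a := by
    rw [hu, star_mul, hastar]; simp only [mul_assoc]
  have hγ (i) (h0 : g i * f ≠ 0) : τ (c * star c * g i) = t₀ * δ i := by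
    have h1 := (hg i).corner_eq hτ (mul_mem hcX (star_mem hcX))
    have h2 := congrArg (fun m => T (m * f)) h1
    simp only [Matrix.smul_mul, map_smul, smul_eq_mul, hT.2.2 _ ((hg i).mul hXY hf h0),
      mul_one] at h2
    rw [← h2, mul_assoc, hgf, ← mul_assoc, mul_assoc (g i), hcc, Matrix.mul_smul, Matrix.smul_mul,
      map_smul, smul_eq_mul]
    congr 1
    rw [← hδ i, mul_assoc (g i), hT.1 _ (hgX i) _ (mul_mem (mul_mem (mul_mem hfX he.1) hfX)
      (hgX i)), mul_assoc, (hg i).2.1.2, mul_assoc, mul_assoc, hT.1 _ hfX _ (mul_mem he.1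
      (mul_mem hfX (hgX i))), mul_assoc, mul_assoc, hgf, ← mul_assoc f f, hff, mul_assoc]
  have hτu : τ (x * (u * star u)) = t₀ * t := by
    have hccX := mul_mem hcX (star_mem hcX)
    have : x * (u * star u) = (x * a) * (c * star c * a) := by
      rw [huu]; simp only [mul_assoc]
    rw [this, hτ.1 _ (mul_mem hx.1 haX) _ (mul_mem hccX haX), mul_assoc, haxa, ha, Finset.mul_sum,
      map_sum, ht]
    push_cast
    rw [Finset.mul_sum]
    refine Finset.sum_congr rfl fun i _ => ?_
    rw [Matrix.mul_smul, map_smul, smul_eq_mul]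
    by_cases h0 : g i * f = 0
    · simp [hβ, h0]
    · rw [hγ i h0]; ring
  have huf : (u * f) * star (u * f) = (t₀ : ℂ) • (a * (f * e * f) * a) := by
    calc (u * f) * star (u * f) = a * (c * (f * f) * star c) * a := by
          rw [star_mul, hu, star_mul, hastar, hf.2.1.star_eq]; simp only [mul_assoc]
      _ = a * (c * star c * f) * a := by
          rw [hff, mul_assoc c f, ← hXY _ (star_mem hcX) f hf.1]; simp only [mul_assoc]
      _ = _ := by rw [hcc, Matrix.mul_smul, Matrix.smul_mul]
  have hTe : T (e * ((u * f) * star (u * f))) = t₀ * t ^ 2 := by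
    have h1 : e * (a * (f * e * f) * a) = (e * (a * f) * e) * (f * a) := by
      simp only [mul_assoc]
    have h2 : T (a * f * e) = t := by
      rw [haf, hT.1 _ (mul_mem hfX haX') _ he.1, ← mul_assoc, hTa]
    rw [huf, Matrix.mul_smul, map_smul, smul_eq_mul, h1, he.corner_eq hT (mul_mem haX' hfX), h2,
      Matrix.smul_mul, map_smul, ← mul_assoc, hTa, smul_eq_mul, sq]
  have hρu : (ρ * (u * star u)).trace = (ρ * ((u * f) * star (u * f))).trace +
      (ρ * ((u * (1 - f)) * star (u * (1 - f)))).trace := by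
    rw [← trace_add, ← mul_add]
    congr 2
    rw [star_mul u f, star_mul u (1 - f), star_sub, star_one, hf.2.1.star_eq]
    calc u * star u = u * (f * f + (1 - f) * (1 - f)) * star u := by
          simp [mul_sub, sub_mul, hff]
      _ = _ := by noncomm_ring
  have hmain : l * (t₀ * t ^ 2) ≤ t₀ * t := by
    have h1 := hl (u * f) (mul_mem huX' hfX)
    rw [hr.2.2 _ (mul_mem (mul_mem huX' hfX) (star_mem (mul_mem huX' hfX))), hTe] at h1
    rw [← hx.2.2 _ (mul_mem huX (star_mem huX)), hτu] at hρu
    have h2 := hρ.trace_mul_mul_star_nonneg (u * (1 - f))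
    have h3 := congrArg Complex.re hρu
    rw [Complex.nonneg_iff] at h2
    rw [Complex.add_re] at h3
    norm_cast at h1 h3
    linarith [h2.1]
  rw [hβδ]
  rcases ht₀0.eq_or_lt with h0 | h0
  · have hfef : f * e * f = 0 := by
      have h1 : star (e * f) * (e * f) = f * e * f := by
        rw [star_mul, he.2.1.star_eq, hf.2.1.star_eq, mul_assoc, ← mul_assoc e, he.2.1.2,
          mul_assoc]
      have h2 : (e * f) * star (e * f) = 0 := by
        rw [star_mul, he.2.1.star_eq, hf.2.1.star_eq, mul_assoc, ← mul_assoc f, hff, ← mul_assoc,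
          ht₀, ← h0]
        simp
      rw [star_eq_conjTranspose, self_mul_conjTranspose_eq_zero] at h2
      rw [← h1, h2, mul_zero]
    have : t = 0 := by
      have h3 : T (e * f * a) = T (f * e * f * a) := by
        have h4 : f * e * f * a = f * (e * f * a) := by simp only [mul_assoc]
        rw [h4, hT.1 f hfX _ (mul_mem (mul_mem he.1 hfX) haX'), mul_assoc _ a, haf,
          ← mul_assoc, mul_assoc e f f, hff]
      rw [h3, hfef, zero_mul, map_zero] at hTa
      exact_mod_cast hTa.symm
    simp [this]
  · have h1 : l * t ^ 2 ≤ t := by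
      have : t₀ * (l * t ^ 2) ≤ t₀ * t := by linarith
      exact le_of_mul_le_mul_left this h0
    by_contra! h2
    have htpos : 0 < t := pos_of_mul_pos_right (one_pos.trans h2) hl0
    nlinarith

/-- The entropy of a restriction is the Shannon entropy of the weights of a decomposition into
minimal projections, and the weights are the values of the state on these projections. -/
theorem IsRestriction.exists_weights {X : StarSubalgebra ℂ (Matrix α α ℂ)} {ρ r : Matrix α α ℂ}
    (hρ : ρ.PosSemidef) {τ : Matrix α α ℂ →ₗ[ℂ] ℂ} (hτ : IsCanonicalTrace X τ)
    (hr : IsRestriction X τ ρ r) :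
    ∃ (ι : Type) (_ : Fintype ι) (g : ι → Matrix α α ℂ) (ν : ι → ℝ),
      (∀ i, IsMinProjOf X (g i)) ∧ (∀ i, r * g i = (ν i : ℂ) • g i) ∧
      (∑ i, g i = 1) ∧ (∀ i j, i ≠ j → g i * g j = 0) ∧ (∀ i, 0 ≤ ν i) ∧
      (∀ i, (ρ * g i).trace = ν i) ∧ algEntropy τ r = ∑ i, negMulLogb (ν i) := by
  have hrh := hr.2.1.isHermitian
  obtain ⟨ι, _, g, ν, hg, hν, hsum, horth⟩ := exists_minProj_decomposition X hr.1 hrh 1 (one_mem X)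
    ⟨isHermitian_one, one_mul 1⟩ (by simp)
  have htr (i) : (ρ * g i).trace = ν i := by
    rw [← hr.2.2 _ (hg i).1, hν, map_smul, hτ.2.2 _ (hg i), smul_eq_mul, mul_one]
  refine ⟨ι, inferInstance, g, ν, hg, hν, hsum, horth, fun i => ?_, htr, ?_⟩
  · have := hρ.trace_mul_mul_star_nonneg (g i)
    rw [(hg i).2.1.star_eq, (hg i).2.1.2, htr] at this
    exact_mod_cast this
  · have : r * matLogb r = ∑ i, (↑(ν i * Real.logb 2 (ν i)) : ℂ) • g i := by
      calc r * matLogb r = ∑ i, r * matLogb r * g i := by rw [← Finset.mul_sum, hsum, mul_one]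
        _ = _ := Finset.sum_congr rfl fun i _ => by
          rw [mul_assoc, matLogb_mul_of_mul_eq_smul hrh (hν i), Matrix.mul_smul, hν, smul_smul,
            mul_comm, Complex.ofReal_mul]
    simp only [algEntropy, this, map_sum, map_smul, hτ.2.2 _ (hg _), negMulLogb, smul_eq_mul,
      mul_one, ← Complex.ofReal_sum, Complex.ofReal_re, Finset.sum_neg_distrib]

end

theorem sum_negMulLogb {S : Type*} [Fintype S] (v : S → ℝ) :
    ∑ s, negMulLogb (v s) = -(∑ s, v s * Real.log (v s)) / Real.log 2 := by
  simp only [negMulLogb, Real.logb, Finset.sum_neg_distrib, neg_div, Finset.sum_div, mul_div_assoc]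

theorem sum_negMulLogb_le_add {I J K : Type*} [Fintype I] [Fintype J] [Fintype K]
    {d : K → J → I → ℝ} (hd : ∀ k j i, 0 ≤ d k j i) {l : K → ℝ} {m : J → ℝ} {ν : I → ℝ}
    (hl : ∀ k, ∑ j, ∑ i, d k j i = l k) (hm : ∀ j, ∑ k, ∑ i, d k j i = m j)
    (hν : ∀ i, ∑ k, ∑ j, d k j i = ν i) (hsum : ∑ k, l k = 1)
    (hdiv : ∀ k j, ∑ i, d k j i / ν i ≤ 1) :
    ∑ i, negMulLogb (ν i) ≤ ∑ j, negMulLogb (m j) + ∑ k, negMulLogb (l k) := by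
  set p : K → J → ℝ := fun k j => ∑ i, d k j i with hp
  have hp0 (k j) : 0 ≤ p k j := Finset.sum_nonneg fun i _ => hd k j i
  have hl0 (k) : 0 ≤ l k := hl k ▸ Finset.sum_nonneg fun j _ => hp0 k j
  have hm0 (j) : 0 ≤ m j := hm j ▸ Finset.sum_nonneg fun k _ => hp0 k j
  have hdp (k j i) : d k j i ≤ p k j :=
    Finset.single_le_sum (f := fun i => d k j i) (fun i _ => hd k j i) (Finset.mem_univ i)
  have hpl (k j) : p k j ≤ l k := by
    rw [← hl k]
    exact Finset.single_le_sum (f := fun j => p k j) (fun j _ => hp0 k j) (Finset.mem_univ j)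
  have hpm (k j) : p k j ≤ m j := by
    rw [← hm j]
    exact Finset.single_le_sum (f := fun k => p k j) (fun k _ => hp0 k j) (Finset.mem_univ k)
  have hdν (k j i) : d k j i ≤ ν i := by
    rw [← hν i]
    exact (Finset.single_le_sum (f := fun j => d k j i) (fun j _ => hd k j i)
      (Finset.mem_univ j)).trans (Finset.single_le_sum (f := fun k => ∑ j, d k j i)
      (fun k _ => Finset.sum_nonneg fun j _ => hd k j i) (Finset.mem_univ k))
  have hterm (k j i) : d k j i * (Real.log (l k) + Real.log (m j) - Real.log (ν i)) ≤
      d k j i * (l k * m j / p k j) + p k j * (d k j i / ν i) - 2 * d k j i := by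
    rcases (hd k j i).eq_or_lt with h | h
    · simp [← h]
    have h1 := h.trans_le (hdp k j i)
    have h2 := h1.trans_le (hpl k j)
    have h3 := h1.trans_le (hpm k j)
    have h4 := h.trans_le (hdν k j i)
    have h5 := Real.log_le_sub_one_of_pos (div_pos (mul_pos h2 h3) h1)
    have h6 := Real.log_le_sub_one_of_pos (div_pos h1 h4)
    rw [Real.log_div (mul_pos h2 h3).ne' h1.ne', Real.log_mul h2.ne' h3.ne'] at h5
    rw [Real.log_div h1.ne' h4.ne'] at h6
    calc _ ≤ d k j i * (l k * m j / p k j + p k j / ν i - 2) :=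
          mul_le_mul_of_nonneg_left (by linarith) h.le
      _ = _ := by ring
  have hm1 : ∑ j, m j = 1 := by
    rw [← hsum, Finset.sum_congr rfl fun j _ => (hm j).symm, Finset.sum_comm]
    exact Finset.sum_congr rfl fun k _ => hl k
  have hp1 : ∑ k, ∑ j, p k j = 1 := by
    rw [← hsum]
    exact Finset.sum_congr rfl fun k _ => hl k
  have hA : ∑ k, ∑ j, ∑ i, d k j i * (l k * m j / p k j) ≤ 1 := by
    calc _ ≤ ∑ k, ∑ j, l k * m j := by
          refine Finset.sum_le_sum fun k _ => Finset.sum_le_sum fun j _ => ?_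
          rw [← Finset.sum_mul]
          change p k j * _ ≤ _
          by_cases h : p k j = 0
          · simpa [h] using mul_nonneg (hl0 k) (hm0 j)
          · rw [mul_div_cancel₀ _ h]
      _ = 1 := by simp_rw [← Finset.mul_sum, hm1, mul_one, hsum]
  have hB : ∑ k, ∑ j, ∑ i, p k j * (d k j i / ν i) ≤ 1 := by
    rw [← hp1]
    refine Finset.sum_le_sum fun k _ => Finset.sum_le_sum fun j _ => ?_
    rw [← Finset.mul_sum]
    exact mul_le_of_le_one_right (hp0 k j) (hdiv k j)
  have hle : ∑ k, ∑ j, ∑ i, d k j i * (Real.log (l k) + Real.log (m j) - Real.log (ν i)) ≤ 0 := by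
    calc _ ≤ ∑ k, ∑ j, ∑ i,
          (d k j i * (l k * m j / p k j) + p k j * (d k j i / ν i) - 2 * d k j i) :=
          Finset.sum_le_sum fun k _ => Finset.sum_le_sum fun j _ => Finset.sum_le_sum fun i _ =>
            hterm k j i
      _ ≤ 0 := by
        simp only [Finset.sum_sub_distrib, Finset.sum_add_distrib, ← Finset.mul_sum] at *
        change _ - 2 * ∑ k, ∑ j, p k j ≤ 0
        linarith
  have hL : ∑ k, ∑ j, ∑ i, d k j i * Real.log (l k) = ∑ k, l k * Real.log (l k) := by
    simp_rw [← Finset.sum_mul, hl]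
  have hM : ∑ k, ∑ j, ∑ i, d k j i * Real.log (m j) = ∑ j, m j * Real.log (m j) := by
    rw [Finset.sum_comm]
    simp_rw [← Finset.sum_mul, hm]
  have hN : ∑ k, ∑ j, ∑ i, d k j i * Real.log (ν i) = ∑ i, ν i * Real.log (ν i) := by
    simp_rw [Finset.sum_comm (s := (Finset.univ : Finset J)) (t := (Finset.univ : Finset I))]
    rw [Finset.sum_comm]
    simp_rw [← Finset.sum_mul, hν]
  simp only [mul_sub, mul_add, Finset.sum_sub_distrib, Finset.sum_add_distrib, hL, hM, hN] at hle
  have hlog : 0 < Real.log 2 := Real.log_pos one_lt_two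
  rw [sum_negMulLogb, sum_negMulLogb, sum_negMulLogb, ← add_div]
  exact div_le_div_of_nonneg_right (by linarith) hlog.le

theorem IsAlgEntropy.le_add {α : Type*} [Fintype α] [DecidableEq α]
    {ρ : Matrix α α ℂ} (hρ : MatState ρ) {X Y : StarSubalgebra ℂ (Matrix α α ℂ)}
    (hXY : CompatibleAlg X Y) {HX HY H : ℝ} (hHX : IsAlgEntropy X ρ HX)
    (hHY : IsAlgEntropy Y ρ HY) (hH : IsAlgEntropy (X ⊔ Y) ρ H) : HX ≤ HY + H := by
  obtain ⟨τ, x, hτ, hx, rfl⟩ := hHX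
  obtain ⟨σ, y, hσ, hy, rfl⟩ := hHY
  obtain ⟨T, r, hT, hr, rfl⟩ := hH
  obtain ⟨I, _, g, ν, hg, hν, hgsum, hgorth, hν0, hνtr, hHx⟩ := hx.exists_weights hρ.1 hτ
  obtain ⟨J, _, f, m, hf, -, hfsum, -, -, hmtr, hHy⟩ := hy.exists_weights hρ.1 hσ
  obtain ⟨K, _, e, l, he, hl, hesum, -, hl0, hltr, hHr⟩ := hr.exists_weights hρ.1 hT
  rw [hHx, hHy, hHr]
  set δ : K → J → I → ℝ := fun k j i => (T (e k * f j * g i)).re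
  have hpos (k j i) := hT.minProj_mul_mul_nonneg hXY (he k) (hf j) (hg i)
  have hδ0 (k j i) : 0 ≤ δ k j i := (Complex.nonneg_iff.1 (hpos k j i)).1
  have hδ (k j i) : T (e k * f j * g i) = δ k j i :=
    Complex.ext (by simp [δ]) (by simp [← (Complex.nonneg_iff.1 (hpos k j i)).2])
  have hgX (i) : g i ∈ X ⊔ Y := (le_sup_left : X ≤ X ⊔ Y) (hg i).1
  have hfX (j) : f j ∈ X ⊔ Y := (le_sup_right : Y ≤ X ⊔ Y) (hf j).1
  have hTr (w : Matrix α α ℂ) : T (r * w) = ∑ k, (l k : ℂ) * T (e k * w) := by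
    calc T (r * w) = T (∑ k, r * e k * w) := by
          rw [← Finset.sum_mul, ← Finset.mul_sum, hesum, mul_one]
      _ = _ := by
          rw [map_sum]
          exact Finset.sum_congr rfl fun k _ => by
            rw [hl, Matrix.smul_mul, map_smul, smul_eq_mul]
  refine sum_negMulLogb_le_add (d := fun k j i => l k * δ k j i)
    (fun k j i => mul_nonneg (hl0 k) (hδ0 k j i)) (fun k => ?_) (fun j => ?_) (fun i => ?_) ?_
    (fun k j => ?_)
  · have : ((∑ j, ∑ i, l k * δ k j i : ℝ) : ℂ) = l k := by
      push_cast
      simp_rw [← hδ, ← Finset.mul_sum, ← map_sum, ← Finset.mul_sum, hgsum, mul_one,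
        ← Finset.mul_sum, hfsum, mul_one, hT.2.2 _ (he k), mul_one]
    exact_mod_cast this
  · have : ((∑ k, ∑ i, l k * δ k j i : ℝ) : ℂ) = m j := by
      push_cast
      simp_rw [← hδ, ← Finset.mul_sum, ← map_sum, ← Finset.mul_sum, hgsum, mul_one, ← hTr,
        hr.2.2 _ (hfX j), hmtr]
    exact_mod_cast this
  · have : ((∑ k, ∑ j, l k * δ k j i : ℝ) : ℂ) = ν i := by
      push_cast
      simp_rw [← hδ, ← Finset.mul_sum, ← map_sum, ← Finset.sum_mul, ← Finset.mul_sum, hfsum,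
        mul_one, ← hTr, hr.2.2 _ (hgX i), hνtr]
    exact_mod_cast this
  · have : ((∑ k, l k : ℝ) : ℂ) = 1 := by
      push_cast
      simp_rw [← hltr, ← trace_sum, ← Finset.mul_sum, hesum, mul_one, hρ.2]
    exact_mod_cast this
  · have := IsRestriction.mul_sum_div_le_one hXY hρ.1 hτ hx hT hr hg hν hgorth (he k) (hf j)
      (l := l k) (hl0 k) (fun z hz => ?_) (hδ k j)
    · simpa only [Finset.mul_sum, mul_div_assoc] using this
    · have hnn (k) : 0 ≤ (T (e k * (z * star z))).re := by
        have h := hT.mul_star_nonneg (mul_mem (he k).1 hz)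
        rw [star_mul, (he k).2.1.star_eq, ← mul_assoc, hT.1 _ (mul_mem (mul_mem (he k).1 hz)
          (star_mem hz)) _ (he k).1, mul_assoc, ← mul_assoc, (he k).2.1.2] at h
        exact (Complex.nonneg_iff.1 h).1
      rw [hTr, Complex.re_sum]
      simp_rw [Complex.re_ofReal_mul]
      exact Finset.single_le_sum (f := fun k => l k * (T (e k * (z * star z))).re)
        (fun k _ => mul_nonneg (hl0 k) (hnn k)) (Finset.mem_univ k)

/-- triangle / Araki–Lieb inequality for compatible subalgebras:
`|H_ρ(𝔛) − H_ρ(𝔜)| ≤ H_ρ(𝔛𝔜)`. -/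
theorem triangle_inequality_subalgebras {n : ℕ}
    (ρ : Matrix (Fin n) (Fin n) ℂ) (hρ : MatState ρ)
    (𝔛 𝔜 : StarSubalgebra ℂ (Matrix (Fin n) (Fin n) ℂ))
    (hcomp : CompatibleAlg 𝔛 𝔜)
    (HX HY HXY : ℝ)
    (hHX : IsAlgEntropy 𝔛 ρ HX) (hHY : IsAlgEntropy 𝔜 ρ HY)
    (hHXY : IsAlgEntropy (𝔛 ⊔ 𝔜) ρ HXY) :
    |HX - HY| ≤ HXY := by
  have h1 := IsAlgEntropy.le_add hρ hcomp hHX hHY hHXY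
  have h2 := IsAlgEntropy.le_add hρ (fun y hy x hx => (hcomp x hx y hy).symm) hHY hHX
    (sup_comm 𝔛 𝔜 ▸ hHXY)
  rw [abs_le]
  constructor <;> linarith
end
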